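/- arXiv:math/9908011 — 2 statements merged into one kernel-verified Lean document; each statement's English description precedes it below -/
import Mathlib

section
/- Let X be a Coxeter graph of type A or B. Every w ∈ W(X) has a reduced expression s_1 s_2 ··· s_n with the deletion property: for any subsequence 1 ≤ i_1 < i_2 < ··· < i_k ≤ n, the product b_{s_{i_1}} b_{s_{i_2}} ··· b_{s_{i_k}} in TL(X) equals a q_c^m b_x for some x ∈ W_c and nonnegative integers a, m with m ≤ n − k. -/
open CoxeterSystem LaurentPolynomial

noncomputable section

/-- The Laurent polynomial ring `A = ℤ[v, v⁻¹]`, with `v = T 1`. -/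
abbrev LA := LaurentPolynomial ℤ

/-- `q_c = v + v⁻¹`. -/
def qc : LA := T 1 + T (-1)

/-- The subring `A⁻ = ℤ[v⁻¹]` of `A`. -/
def LAminus : Subring LA := Subring.closure {T (-1)}

variable {B : Type*} {W : Type*} [Group W]

/-- `w` is complex: it has a reduced factorization `x₁ * w_{ss'} * x₂`, where `w_{ss'}` is the
longest element of a finite rank-2 parabolic subgroup `⟨s, s'⟩` with `s`, `s'` non-commuting
(`3 ≤ M i i'`, which also excludes infinite bonds `M i i' = 0`). -/
def CoxeterSystem.IsComplexElt {M : CoxeterMatrix B} (cs : CoxeterSystem M W) (w : W) : Prop :=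
  ∃ (x₁ x₂ : W) (i i' : B), 3 ≤ M i i' ∧
    w = x₁ * cs.wordProd (CoxeterSystem.braidWord M i i') * x₂ ∧
    cs.length w = cs.length x₁ + M i i' + cs.length x₂

/-- `w` is fully commutative, i.e. not complex; `cs.FC` plays the role of the set `W_c`. -/
def CoxeterSystem.FC {M : CoxeterMatrix B} (cs : CoxeterSystem M W) (w : W) : Prop :=
  ¬ cs.IsComplexElt w

/-- Bruhat--Chevalley order, via the subword characterization. -/
def CoxeterSystem.BruhatLE {M : CoxeterMatrix B} (cs : CoxeterSystem M W) (x w : W) : Prop :=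
  ∃ ω : List B, cs.IsReduced ω ∧ cs.wordProd ω = w ∧
    ∃ κ : List B, κ.Sublist ω ∧ cs.wordProd κ = x

/-- The defining relations of the generalized Temperley--Lieb algebra `TL(X)`. -/
inductive TLRel (M : CoxeterMatrix B) : FreeAlgebra LA B → FreeAlgebra LA B → Prop
  | sq (i : B) : TLRel M (FreeAlgebra.ι LA i * FreeAlgebra.ι LA i) (qc • FreeAlgebra.ι LA i)
  | comm (i i' : B) : M i i' = 2 → TLRel M (FreeAlgebra.ι LA i * FreeAlgebra.ι LA i')
      (FreeAlgebra.ι LA i' * FreeAlgebra.ι LA i)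
  | braid3 (i i' : B) : M i i' = 3 → TLRel M
      (FreeAlgebra.ι LA i * FreeAlgebra.ι LA i' * FreeAlgebra.ι LA i) (FreeAlgebra.ι LA i)
  | braid4 (i i' : B) : M i i' = 4 → TLRel M
      (FreeAlgebra.ι LA i * FreeAlgebra.ι LA i' * FreeAlgebra.ι LA i * FreeAlgebra.ι LA i')
      (2 * (FreeAlgebra.ι LA i * FreeAlgebra.ι LA i'))

/-- The generalized Temperley--Lieb algebra `TL(X)` as an `A`-algebra. -/
abbrev TL (M : CoxeterMatrix B) := RingQuot (TLRel M)

/-- The generator `b_s` of `TL(X)`. -/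
def bgen (M : CoxeterMatrix B) (i : B) : TL M :=
  RingQuot.mkAlgHom LA (TLRel M) (FreeAlgebra.ι LA i)

/-- The product `b_{s_1} b_{s_2} ⋯ b_{s_n}` over a word; for a reduced word of a fully
commutative element this is the monomial basis element `b_w`. -/
def bprod (M : CoxeterMatrix B) (ω : List B) : TL M := (ω.map (bgen M)).prod

/-! ### Part 1: the exchange property -/

section Exchange

variable {M : CoxeterMatrix B} (cs : CoxeterSystem M W)

open Classical in
/-- Action of a generator on `W × ZMod 2`, used to prove the exchange property. -/
def exF (i : B) : Function.End (W × ZMod 2) := fun p =>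
  (cs.simple i * p.1 * cs.simple i, p.2 + if p.1 = cs.simple i then 1 else 0)

open Classical in
theorem exF_pow (i j : B) (k : ℕ) (t : W) (ε : ZMod 2) :
    ((exF cs i * exF cs j) ^ k) (t, ε) =
      ((cs.simple i * cs.simple j) ^ k * t * (cs.simple j * cs.simple i) ^ k,
        ε + ∑ l ∈ Finset.range (2 * k),
          if t = (cs.simple j * cs.simple i) ^ l * cs.simple j then 1 else 0) := by
  induction k with
  | zero => simp; rfl
  | succ k ih =>
    rw [pow_succ']
    change (exF cs i * exF cs j) (((exF cs i * exF cs j) ^ k) (t, ε)) = _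
    rw [ih]
    change exF cs i (exF cs j _) = _
    set x := cs.simple i * cs.simple j with hx
    set y := cs.simple j * cs.simple i with hy
    have hxy : x = y⁻¹ := by simp [hx, hy]
    have hsy : ∀ l : ℕ, y ^ l * cs.simple j = cs.simple j * x ^ l := by
      intro l
      induction l with
      | zero => simp
      | succ l ihl =>
        rw [pow_succ', mul_assoc, ihl, pow_succ' x, hx, hy]
        simp [mul_assoc]
    have hxk : x ^ k = (y ^ k)⁻¹ := by rw [hxy, inv_pow]
    have e1 : (x ^ k * t * y ^ k = cs.simple j) ↔ t = y ^ (2 * k) * cs.simple j := by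
      rw [two_mul, pow_add, mul_assoc (y ^ k), hsy k, hxk]
      constructor
      · intro h; rw [← h]; group
      · intro h; rw [h]; group
    have e2 : (cs.simple j * (x ^ k * t * y ^ k) * cs.simple j = cs.simple i) ↔
        t = y ^ (2 * k + 1) * cs.simple j := by
      have : y ^ (2 * k + 1) * cs.simple j =
          y ^ k * (cs.simple j * cs.simple i * cs.simple j) * x ^ k := by
        rw [show 2 * k + 1 = k + 1 + k by ring, pow_add, mul_assoc, hsy k, pow_succ, hy]
        simp only [mul_assoc]
      rw [this, hxk]
      constructor
      · intro h
        rw [← h]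
        simp only [mul_assoc, cs.simple_mul_simple_cancel_left]
        simp
      · intro h
        rw [h]
        simp [mul_assoc]
    simp only [exF]
    rw [Prod.mk.injEq]
    constructor
    · rw [pow_succ' x, pow_succ y, hx, hy]; simp only [mul_assoc]
    · rw [show 2 * (k + 1) = 2 * k + 1 + 1 by ring, Finset.sum_range_succ, Finset.sum_range_succ]
      simp only [e1, e2, add_assoc]

theorem exF_liftable : M.IsLiftable (exF cs) := by
  classical
  intro i j
  funext p
  obtain ⟨t, ε⟩ := p
  rw [exF_pow]
  have h1 := cs.simple_mul_simple_pow i j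
  have h2 : (cs.simple j * cs.simple i) ^ M i j = 1 := by
    rw [M.symmetric i j]; exact cs.simple_mul_simple_pow j i
  have : (1 : Function.End (W × ZMod 2)) (t, ε) = (t, ε) := rfl
  rw [this, h1, h2, two_mul, Finset.sum_range_add]
  simp only [pow_add, h2, one_mul, mul_one, ← two_mul]
  rw [show (2 : ZMod 2) = 0 from rfl]
  simp

open Classical in
theorem exF_word (ω : List B) (t : W) (ε : ZMod 2) :
    (ω.map (exF cs)).prod (t, ε) =
      (cs.wordProd ω * t * (cs.wordProd ω)⁻¹, ε + ((cs.rightInvSeq ω).count t : ZMod 2)) := by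
  induction ω with
  | nil => simp; rfl
  | cons i ω ih =>
    rw [List.map_cons, List.prod_cons]
    change exF cs i ((ω.map (exF cs)).prod (t, ε)) = _
    rw [ih]
    simp only [exF, rightInvSeq, List.count_cons, wordProd_cons]
    rw [Prod.mk.injEq]
    constructor
    · simp [mul_assoc]
    · have : (cs.wordProd ω * t * (cs.wordProd ω)⁻¹ = cs.simple i) ↔
          (cs.wordProd ω)⁻¹ * cs.simple i * cs.wordProd ω = t := by
        constructor
        · intro h; rw [← h]; group
        · intro h; rw [← h]; group
      simp only [this, beq_iff_eq]
      split_ifs <;> push_cast <;> ring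

open Classical in
theorem count_ris_congr {ω ω' : List B} (h : cs.wordProd ω = cs.wordProd ω') (t : W) :
    ((cs.rightInvSeq ω).count t : ZMod 2) = ((cs.rightInvSeq ω').count t : ZMod 2) := by
  have key : ∀ ω : List B, cs.lift ⟨exF cs, exF_liftable cs⟩ (cs.wordProd ω) =
      (ω.map (exF cs)).prod := by
    intro ω
    rw [wordProd, map_list_prod, List.map_map]
    congr 1
    apply List.map_congr_left
    intro i _
    simp
  have h1 := key ω
  rw [h, key ω'] at h1
  have h2 := congrFun h1 (t, 0)
  rw [exF_word, exF_word] at h2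
  have := congrArg Prod.snd h2
  simpa using this.symm

/-- The exchange property. -/
theorem exchange {ω : List B} {s : B} (hs : cs.IsRightDescent (cs.wordProd ω) s) :
    ∃ a i b, ω = a ++ i :: b ∧ cs.wordProd ω * cs.simple s = cs.wordProd (a ++ b) := by
  classical
  obtain ⟨ω', hω', he⟩ := cs.exists_isReduced (cs.wordProd ω * cs.simple s)
  have h1 : cs.wordProd ω = cs.wordProd (ω'.concat s) := by
    rw [wordProd_concat, ← he]; simp
  have h2 := count_ris_congr cs h1 (cs.simple s)
  rw [rightInvSeq_concat] at h2
  have h3 : cs.simple s ∉ cs.rightInvSeq ω' := by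
    intro hm
    have := (cs.isRightInversion_of_mem_rightInvSeq hω' hm).2
    rw [← he] at this
    simp only [simple_mul_simple_cancel_right] at this
    exact absurd hs (by unfold IsRightDescent; omega)
  have h4 : (List.map (⇑(MulAut.conj (cs.simple s))) (cs.rightInvSeq ω')).count (cs.simple s) = 0 := by
    rw [List.count_eq_zero]
    intro hm
    rw [List.mem_map] at hm
    obtain ⟨x, hx, hxe⟩ := hm
    have : x = cs.simple s := by
      rw [MulAut.conj_apply] at hxe
      have h := congrArg (fun z => cs.simple s * z * cs.simple s) hxe
      simpa [mul_assoc] using h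
    exact h3 (this ▸ hx)
  rw [List.concat_eq_append, List.count_append, h4] at h2
  have h5 : cs.simple s ∈ cs.rightInvSeq ω := by
    by_contra hn
    rw [List.count_eq_zero.2 hn] at h2
    simp at h2
  obtain ⟨j, hj, hje⟩ := List.mem_iff_getElem.mp h5
  have h6 := cs.wordProd_mul_getD_rightInvSeq ω j
  rw [List.getD_eq_getElem _ 1 hj, hje] at h6
  rw [length_rightInvSeq] at hj
  refine ⟨ω.take j, ω[j], ω.drop (j + 1), ?_, ?_⟩
  · rw [List.getElem_cons_drop, List.take_append_drop]
  · rw [h6, List.eraseIdx_eq_take_drop_succ]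

end Exchange

/-! ### Part 2: the geometric representation and dihedral facts -/

section Geo

variable {n : ℕ} {M : CoxeterMatrix (Fin n)} (cs : CoxeterSystem M W)

/-- All entries of the Coxeter matrix are among `1, 2, 3, 4`. -/
def SmallM (M : CoxeterMatrix (Fin n)) : Prop :=
  ∀ i j, M i j = 1 ∨ M i j = 2 ∨ M i j = 3 ∨ M i j = 4

/-- An integral Cartan matrix. -/
def cart (M : CoxeterMatrix (Fin n)) (i j : Fin n) : ℤ :=
  if M i j = 1 then 2 else if M i j = 2 then 0 else if M i j = 3 then -1
    else if i < j then -1 else -2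

/-- The coroot functional. -/
def coroot (M : CoxeterMatrix (Fin n)) (i : Fin n) : (Fin n → ℤ) →ₗ[ℤ] ℤ :=
  Fintype.linearCombination ℤ (cart M i)

theorem coroot_single (i j : Fin n) : coroot M i (Pi.single j 1) = cart M i j := by
  simp [coroot]

/-- The simple reflection on the root lattice. -/
def reflM (M : CoxeterMatrix (Fin n)) (i : Fin n) : Module.End ℤ (Fin n → ℤ) :=
  LinearMap.id - (coroot M i).smulRight (Pi.single i 1)

theorem reflM_apply (i : Fin n) (x : Fin n → ℤ) :
    reflM M i x = x - coroot M i x • Pi.single i 1 := by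
  simp [reflM]

theorem M_eq_one {i j : Fin n} : M i j = 1 ↔ i = j := by
  constructor
  · intro h; by_contra hne; exact M.off_diagonal i j hne h
  · rintro rfl; exact M.diagonal i

theorem reflM_liftable (h4 : SmallM M) : M.IsLiftable (reflM M) := by
  intro i j
  have hii : cart M i i = 2 := by simp [cart]
  have hjj : cart M j j = 2 := by simp [cart]
  have hsym := M.symmetric i j
  have key : ∀ a b : ℤ, cart M i j = a → cart M j i = b → ∀ x,
      (reflM M i * reflM M j) x = x - coroot M j x • Pi.single j 1
        - (coroot M i x - coroot M j x * a) • Pi.single i 1 := by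
    intro a b ha hb x
    rw [Module.End.mul_apply, reflM_apply, reflM_apply]
    simp only [map_sub, map_smul, coroot_single, ha, smul_eq_mul]
  have ci : ∀ a, cart M i j = a → ∀ b, cart M j i = b → ∀ x,
      coroot M i ((reflM M i * reflM M j) x) = - coroot M i x + coroot M j x * a := by
    intro a ha b hb x
    rw [key a b ha hb]
    simp only [map_sub, map_smul, coroot_single, ha, smul_eq_mul, hii]; ring
  have cj : ∀ a, cart M i j = a → ∀ b, cart M j i = b → ∀ x,
      coroot M j ((reflM M i * reflM M j) x) =
        - coroot M j x - coroot M i x * b + coroot M j x * a * b := by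
    intro a ha b hb x
    rw [key a b ha hb]
    simp only [map_sub, map_smul, coroot_single, hb, smul_eq_mul, hjj]; ring
  rcases h4 i j with h | h | h | h
  · rw [h]
    have := M_eq_one.1 h
    subst this
    ext1 x
    ext1
    simp only [LinearMap.comp_apply, pow_one, Module.End.mul_apply, reflM_apply, map_sub, map_smul, coroot_single, hii]
    simp only [Module.End.one_apply, smul_eq_mul]
    module
  · have ha : cart M i j = 0 := by simp [cart, h]
    have hb : cart M j i = 0 := by simp [cart, ← hsym, h]
    rw [h]
    have key1 := key _ _ ha hb
    have ci1 := ci _ ha _ hb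
    have cj1 := cj _ ha _ hb
    clear key ci cj
    generalize reflM M i * reflM M j = g at *
    refine LinearMap.ext fun x => ?_
    simp only [pow_succ, pow_zero, one_mul, Module.End.mul_apply, Module.End.one_apply]
    rw [key1 (g x), ci1, cj1, key1]
    module
  · have ha : cart M i j = -1 := by simp [cart, h]
    have hb : cart M j i = -1 := by simp [cart, ← hsym, h]
    rw [h]
    have key1 := key _ _ ha hb
    have ci1 := ci _ ha _ hb
    have cj1 := cj _ ha _ hb
    clear key ci cj
    generalize reflM M i * reflM M j = g at *
    refine LinearMap.ext fun x => ?_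
    simp only [pow_succ, pow_zero, one_mul, Module.End.mul_apply, Module.End.one_apply]
    rw [key1 (g (g x)), ci1 (g x), cj1 (g x), key1 (g x), ci1, cj1, key1]
    module
  · have hne : i ≠ j := by
      intro he; rw [M_eq_one.2 he] at h; omega
    rw [h]
    have fin : ∀ a b : ℤ, cart M i j = a → cart M j i = b → a * b = 2 →
        (reflM M i * reflM M j) ^ 4 = 1 := by
      intro a b ha hb hab
      have key1 := key _ _ ha hb
      have ci1 := ci _ ha _ hb
      have cj1 := cj _ ha _ hb
      clear key ci cj
      generalize reflM M i * reflM M j = g at *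
      have cj2 : ∀ x, coroot M j (g x) = coroot M j x - coroot M i x * b := by
        intro x; rw [cj1, mul_assoc, hab]; ring
      have hg2 : ∀ x, coroot M i (g (g x)) = - coroot M i x := by
        intro x; rw [ci1, ci1, cj2]; linear_combination (-coroot M i x) * hab
      have hg3 : ∀ x, coroot M j (g (g x)) = - coroot M j x := by
        intro x; rw [cj2, cj2, ci1]; linear_combination (-coroot M j x) * hab
      have sq : ∀ x, g (g x) = x - (2 * coroot M j x - coroot M i x * b) • Pi.single j 1
          - (coroot M i x * 2 - 2 * coroot M i x + coroot M i x * a * b - coroot M j x * a) •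
            Pi.single i 1 := by
        intro x
        rw [key1 (g x), ci1, cj2, key1]
        module
      refine LinearMap.ext fun x => ?_
      simp only [pow_succ, pow_zero, one_mul, Module.End.mul_apply, Module.End.one_apply]
      rw [sq (g (g x)), hg2, hg3, sq]
      module
    rcases lt_or_gt_of_ne hne with hl | hl
    · exact fin (-1) (-2) (by simp [cart, h, hl]) (by simp [cart, ← hsym, h, hl.le]) (by norm_num)
    · exact fin (-2) (-1) (by simp [cart, h, hl.le]) (by simp [cart, ← hsym, h, hl]) (by norm_num)

theorem simple_inj (h4 : SmallM M) {i j : Fin n} (h : cs.simple i = cs.simple j) : i = j := by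
  by_contra hne
  have h1 := congrArg (cs.lift ⟨reflM M, reflM_liftable h4⟩) h
  rw [lift_apply_simple, lift_apply_simple] at h1
  have h2 := congrFun (congrArg (fun f : Module.End ℤ (Fin n → ℤ) => f (Pi.single i 1)) h1) i
  have hii : cart M i i = 2 := by simp [cart]
  simp only [reflM_apply, coroot_single, hii, Pi.sub_apply, Pi.smul_apply, Pi.single_eq_same,
    Pi.single_eq_of_ne hne] at h2
  norm_num at h2

theorem simple_not_comm (h4 : SmallM M) {i j : Fin n} (hm : 3 ≤ M i j) :
    cs.simple i * cs.simple j ≠ cs.simple j * cs.simple i := by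
  intro h
  have hne : i ≠ j := by
    intro he; rw [M_eq_one.2 he] at hm; omega
  have h1 := congrArg (cs.lift ⟨reflM M, reflM_liftable h4⟩) h
  rw [map_mul, map_mul, lift_apply_simple, lift_apply_simple] at h1
  have h2 := congrFun (congrArg (fun f : Module.End ℤ (Fin n → ℤ) => f (Pi.single j 1)) h1) i
  have hc : cart M i j ≠ 0 := by
    unfold cart
    rw [if_neg (by omega), if_neg (by omega)]
    split_ifs <;> norm_num
  have hjj : cart M j j = 2 := by simp [cart]
  simp only [Module.End.mul_apply, reflM_apply, coroot_single, map_sub, map_smul, hjj] at h2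
  simp [hne] at h2
  omega

theorem simple_comm {i j : Fin n} (hm : M i j = 2) :
    cs.simple i * cs.simple j = cs.simple j * cs.simple i := by
  have h := cs.simple_mul_simple_pow i j
  rw [hm, pow_two] at h
  have := eq_inv_of_mul_eq_one_left h
  simpa using this

theorem ne_of_M {i j : Fin n} (hm : 2 ≤ M i j) : i ≠ j := by
  rintro rfl; rw [M_eq_one.2 rfl] at hm; omega

/-- Two descents: first step. -/
theorem two_desc (h4 : SmallM M) {x : W} {s t : Fin n} (hst : s ≠ t) (hs : cs.IsRightDescent x s)
    (ht : cs.IsRightDescent x t) :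
    ∃ v, x = v * cs.simple s * cs.simple t ∧ cs.length x = cs.length v + 2 := by
  obtain ⟨ω, hω, he⟩ := cs.exists_isReduced (x * cs.simple s)
  have hx : x = cs.wordProd (ω ++ [s]) := by
    rw [wordProd_append, ← he]; simp
  have hl : cs.length x = ω.length + 1 := by
    rw [isRightDescent_iff, he, hω.eq] at hs; exact hs.symm
  rw [hx] at ht
  obtain ⟨a, i, b, h1, h2⟩ := exchange cs ht
  rcases List.eq_nil_or_concat b with rfl | ⟨b', k, rfl⟩
  · exfalso
    have := List.append_inj' h1 rfl
    obtain ⟨rfl, h3⟩ := this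
    rw [← hx, List.append_nil, ← he] at h2
    exact hst (simple_inj cs h4 (mul_left_cancel h2)).symm
  · have h3 : ω ++ [s] = (a ++ i :: b') ++ [k] := by rw [h1]; simp
    have := List.append_inj' h3 rfl
    obtain ⟨rfl, h5⟩ := this
    have h6 : s = k := by simpa using h5
    subst h6
    rw [← hx] at h2
    have hxe : x = cs.wordProd (a ++ b') * cs.simple s * cs.simple t := by
      have h7 := congrArg (· * cs.simple t) h2
      simp only [simple_mul_simple_cancel_right] at h7
      rw [h7]; simp [wordProd_append, mul_assoc]
    refine ⟨cs.wordProd (a ++ b'), hxe, ?_⟩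
    have l1 := cs.length_wordProd_le (a ++ b')
    have l2 := cs.length_mul_le (cs.wordProd (a ++ b') * cs.simple s) (cs.simple t)
    have l3 := cs.length_mul_le (cs.wordProd (a ++ b')) (cs.simple s)
    rw [← hxe] at l2
    simp only [length_simple, List.length_append, List.length_cons] at *
    omega

/-- Extension step: if `x = v u` with additive lengths and `s` is a descent not accounted for by
deleting a letter of `u`, then `x = v' u s`. -/
theorem desc_step {x v : W} {u : List (Fin n)} {s : Fin n}
    (hx : x = v * cs.wordProd u) (hl : cs.length x = cs.length v + u.length)
    (hs : cs.IsRightDescent x s)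
    (hu : ∀ a i b, u = a ++ i :: b → cs.wordProd u * cs.simple s ≠ cs.wordProd (a ++ b)) :
    ∃ v', x = v' * cs.wordProd (u ++ [s]) ∧ cs.length x = cs.length v' + (u.length + 1) := by
  obtain ⟨ω, hω, he⟩ := cs.exists_isReduced v
  have hx' : x = cs.wordProd (ω ++ u) := by rw [wordProd_append, ← he, hx]
  rw [hx'] at hs
  obtain ⟨a, i, b, h1, h2⟩ := exchange cs hs
  rw [List.append_eq_append_iff] at h1
  rcases h1 with ⟨a', ha, hb⟩ | ⟨c', ha, hb⟩
  · exfalso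
    apply hu a' i b hb
    rw [ha, wordProd_append, List.append_assoc, wordProd_append, mul_assoc] at h2
    exact mul_left_cancel h2
  · rcases c' with _ | ⟨c, c'⟩
    · exfalso
      apply hu [] i b (by simpa using hb.symm)
      simp only [List.append_nil] at ha
      rw [ha, wordProd_append, wordProd_append, mul_assoc] at h2
      simpa using mul_left_cancel h2
    · simp only [List.cons_append, List.cons.injEq] at hb
      obtain ⟨rfl, rfl⟩ := hb
      have hxe : x = cs.wordProd (a ++ c') * cs.wordProd (u ++ [s]) := by
        rw [← hx'] at h2
        have h7 := congrArg (· * cs.simple s) h2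
        simp only [simple_mul_simple_cancel_right] at h7
        rw [h7]; simp [wordProd_append, mul_assoc]
      refine ⟨cs.wordProd (a ++ c'), hxe, ?_⟩
      have l1 := cs.length_wordProd_le (a ++ c')
      have l2 := cs.length_mul_le (cs.wordProd (a ++ c')) (cs.wordProd (u ++ [s]))
      have l3 := cs.length_wordProd_le (u ++ [s])
      rw [← hxe] at l2
      have l4 : cs.length v = ω.length := by rw [he]; exact hω
      have l5 : ω.length = a.length + (c'.length + 1) := by rw [ha]; simp
      simp only [List.length_append, List.length_cons, List.length_nil] at *
      omega

/-- The word `D` with `D t s` the longest word of `⟨s, t⟩`, for bonds 3, 4. -/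
def dw (M : CoxeterMatrix (Fin n)) (s t : Fin n) : List (Fin n) :=
  if M s t = 3 then [s] else [t, s]

theorem three_desc (h4 : SmallM M) {x : W} {s t : Fin n} (hm : 3 ≤ M s t)
    (hs : cs.IsRightDescent x s) (ht : cs.IsRightDescent x t) :
    ∃ v, x = v * cs.wordProd [s, t, s] ∧ cs.length x = cs.length v + 3 := by
  have hne := ne_of_M (M := M) (i := s) (j := t) (by omega)
  have hnc := simple_not_comm cs h4 hm
  have hinj : cs.simple s ≠ cs.simple t := fun h => hne (simple_inj cs h4 h)
  obtain ⟨v, hv, hl⟩ := two_desc cs h4 hne hs ht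
  refine desc_step cs (u := [s, t]) (v := v) (by simpa [wordProd_cons, mul_assoc] using hv)
    (by simpa using hl) hs ?_
  intro a i b hab he
  rcases a with _ | ⟨a0, a⟩
  · simp at hab
    obtain ⟨rfl, rfl⟩ := hab
    simp [wordProd_cons] at he
    apply hnc
    have := congrArg (· * cs.simple s) he
    simpa using this
  · rcases a with _ | ⟨a1, a⟩
    · simp at hab
      obtain ⟨rfl, rfl, rfl⟩ := hab
      simp [wordProd_cons, mul_assoc] at he
      apply hinj
      have := congrArg (cs.simple t * ·) he
      simpa using this
    · simp at hab

theorem full_desc (h4 : SmallM M) {x : W} {s t : Fin n} (hm : 3 ≤ M s t)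
    (hs : cs.IsRightDescent x s) (ht : cs.IsRightDescent x t) :
    ∃ v, x = v * cs.wordProd (dw M s t ++ [t, s]) ∧
      cs.length x = cs.length v + (dw M s t ++ [t, s]).length := by
  by_cases h3 : M s t = 3
  · simpa [dw, h3] using three_desc cs h4 hm hs ht
  have hm4 : M s t = 4 := by have := h4 s t; omega
  have hne := ne_of_M (M := M) (i := s) (j := t) (by omega)
  have hnc := simple_not_comm cs h4 hm
  have hinj : cs.simple s ≠ cs.simple t := fun h => hne (simple_inj cs h4 h)
  obtain ⟨v, hv, hl⟩ := three_desc cs h4 (s := t) (t := s) (by rw [M.symmetric]; exact hm) ht hs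
  simp only [dw, h3, if_false]
  refine desc_step cs (u := [t, s, t]) (v := v) hv (by simpa using hl) hs ?_
  have hpow := cs.simple_mul_simple_pow s t
  rw [hm4] at hpow
  intro a i b hab he
  rcases a with _ | ⟨a0, a⟩
  · simp at hab
    obtain ⟨rfl, rfl⟩ := hab
    -- tsts = st
    simp [wordProd_cons, mul_assoc] at he
    have h1 : cs.simple s * cs.simple t * (cs.simple s * cs.simple t) *
      (cs.simple s * cs.simple t * (cs.simple s * cs.simple t)) = 1 := by
      rw [← hpow]; simp only [pow_succ, pow_zero, one_mul, mul_assoc]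
    have h2 := eq_inv_of_mul_eq_one_left h1
    simp only [mul_inv_rev, inv_simple, mul_assoc] at h2
    rw [he] at h2
    apply hinj
    have h3 := mul_left_cancel (mul_left_cancel (h2.trans (mul_one _).symm |>.trans (mul_assoc _ _ _)))
    have h5 := congrArg (· * cs.simple t) h3
    simpa using h5
  · rcases a with _ | ⟨a1, a⟩
    · simp at hab
      obtain ⟨rfl, rfl, rfl⟩ := hab
      simp [wordProd_cons, mul_assoc] at he
      have h1 : (cs.simple t * cs.simple s) * (cs.simple t * cs.simple s) = 1 := by
        simpa [mul_assoc] using he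
      have := eq_inv_of_mul_eq_one_left h1
      apply hnc
      simpa using this.symm
    · rcases a with _ | ⟨a2, a⟩
      · simp at hab
        obtain ⟨rfl, rfl, rfl, rfl⟩ := hab
        simp [wordProd_cons, mul_assoc] at he
        apply hinj
        have := congrArg (cs.simple t * ·) he
        simpa using this
      · simp at hab

end Geo

/-! ### Part 3: fully commutative elements -/

section FCpart

variable {n : ℕ} {M : CoxeterMatrix (Fin n)} (cs : CoxeterSystem M W)

theorem bprod_append (a b : List (Fin n)) : bprod M (a ++ b) = bprod M a * bprod M b := by
  simp [bprod]

theorem bprod_cons (a : Fin n) (b : List (Fin n)) : bprod M (a :: b) = bgen M a * bprod M b := by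
  simp [bprod]

theorem bprod_nil : bprod M [] = 1 := by
  simp [bprod]

theorem bgen_sq (i : Fin n) : bgen M i * bgen M i = qc • bgen M i := by
  unfold bgen
  rw [← map_mul, RingQuot.mkAlgHom_rel LA (TLRel.sq i), map_smul]

theorem bgen_comm {i j : Fin n} (h : M i j = 2) : bgen M i * bgen M j = bgen M j * bgen M i := by
  unfold bgen
  rw [← map_mul, RingQuot.mkAlgHom_rel LA (TLRel.comm i j h), map_mul]

theorem bgen_three {i j : Fin n} (h : M i j = 3) :
    bgen M i * bgen M j * bgen M i = bgen M i := by
  unfold bgen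
  rw [← map_mul, ← map_mul, RingQuot.mkAlgHom_rel LA (TLRel.braid3 i j h)]

theorem bgen_four {i j : Fin n} (h : M i j = 4) :
    bgen M i * bgen M j * bgen M i * bgen M j = 2 * (bgen M i * bgen M j) := by
  unfold bgen
  rw [← map_mul, ← map_mul, ← map_mul, RingQuot.mkAlgHom_rel LA (TLRel.braid4 i j h), map_mul,
    map_mul, map_ofNat]

theorem bprod_comm {s : Fin n} {l : List (Fin n)} (h : ∀ r ∈ l, M s r = 2) :
    bgen M s * bprod M l = bprod M l * bgen M s := by
  induction l with
  | nil => simp [bprod]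
  | cons a l ih =>
    rw [bprod_cons, ← mul_assoc, bgen_comm (h a (by simp)), mul_assoc,
      ih (fun r hr => h r (by simp [hr])), mul_assoc]

theorem word_comm {s : Fin n} {l : List (Fin n)} (h : ∀ r ∈ l, M s r = 2) :
    cs.simple s * cs.wordProd l = cs.wordProd l * cs.simple s := by
  induction l with
  | nil => simp
  | cons a l ih =>
    rw [wordProd_cons, ← mul_assoc, simple_comm cs (h a (by simp)), mul_assoc,
      ih (fun r hr => h r (by simp [hr])), mul_assoc]

theorem dw_alg (h4 : SmallM M) {s t : Fin n} (hm : 3 ≤ M s t) :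
    ∃ a : ℕ, bprod M (dw M s t) * bgen M t * bgen M s = a • bprod M (dw M s t) := by
  by_cases h3 : M s t = 3
  · refine ⟨1, ?_⟩
    simp only [dw, h3, if_true, bprod_cons, bprod_nil, mul_one, one_smul]
    exact bgen_three h3
  · have hm4 : M t s = 4 := by have := h4 s t; rw [M.symmetric]; omega
    refine ⟨2, ?_⟩
    simp only [dw, h3, if_false, bprod_cons, bprod_nil, mul_one]
    rw [bgen_four hm4, nsmul_eq_mul]; norm_num

theorem dw_sub {s t : Fin n} {r : Fin n} (hr : r ∈ dw M s t) : r = s ∨ r = t := by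
  unfold dw at hr
  split_ifs at hr <;> simp at hr <;> tauto

theorem dw_last (s t : Fin n) : ∃ l, dw M s t = l ++ [s] := by
  unfold dw
  split_ifs
  · exact ⟨[], rfl⟩
  · exact ⟨[t], rfl⟩

theorem s_mem_dw (s t : Fin n) : s ∈ dw M s t := by
  unfold dw; split_ifs <;> simp

theorem length_braidWord' (i j : Fin n) : (braidWord M i j).length = M i j := by
  simp [braidWord]

theorem fc_mid {x a u b : W} (h : cs.FC x) (hx : x = a * u * b)
    (hl : cs.length x = cs.length a + cs.length u + cs.length b) : cs.FC u := by
  rintro ⟨x1, x2, i, j, hm, hu, hlu⟩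
  apply h
  refine ⟨a * x1, x2 * b, i, j, hm, by rw [hx, hu]; simp only [mul_assoc], ?_⟩
  have l1 := cs.length_mul_le a x1
  have l2 := cs.length_mul_le x2 b
  have l3 := cs.length_wordProd_le (braidWord M i j)
  rw [length_braidWord'] at l3
  have l4 := cs.length_mul_le (a * x1 * cs.wordProd (braidWord M i j)) (x2 * b)
  have l5 := cs.length_mul_le (a * x1) (cs.wordProd (braidWord M i j))
  have : x = a * x1 * cs.wordProd (braidWord M i j) * (x2 * b) := by
    rw [hx, hu]; simp only [mul_assoc]
  rw [← this] at l4
  omega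

theorem fc_left {x u b : W} (h : cs.FC x) (hx : x = u * b)
    (hl : cs.length x = cs.length u + cs.length b) : cs.FC u :=
  fc_mid cs h (a := 1) (by simpa using hx) (by simpa using hl)

theorem braid_dw {s t : Fin n} (h4 : SmallM M) (hm : 3 ≤ M s t) :
    dw M s t ++ [t, s] = braidWord M t s := by
  have hs : M t s = M s t := M.symmetric t s
  unfold braidWord dw
  by_cases h3 : M s t = 3
  · simp [hs, h3, alternatingWord]
  · have hm4 : M s t = 4 := by have := h4 s t; omega
    simp [hs, hm4, alternatingWord]

theorem not_fc_dw (h4 : SmallM M) {x v y : W} {s t : Fin n} (hm : 3 ≤ M s t)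
    (hx : x = v * cs.wordProd (dw M s t ++ [t, s]) * y)
    (hl : cs.length x = cs.length v + (dw M s t ++ [t, s]).length + cs.length y) : ¬ cs.FC x := by
  intro h
  rw [braid_dw h4 hm] at hx hl
  rw [length_braidWord'] at hl
  exact h ⟨v, y, t, s, by rw [M.symmetric]; exact hm, hx, hl⟩

theorem M_ge {s t : Fin n} (h4 : SmallM M) (hne : s ≠ t) (h2 : M s t ≠ 2) : 3 ≤ M s t := by
  have h1 : M s t ≠ 1 := fun h => hne (M_eq_one.1 h)
  have := h4 s t
  omega

theorem n1 (h4 : SmallM M) {x : W} {s t : Fin n} (h : cs.FC x) (hs : cs.IsRightDescent x s)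
    (ht : cs.IsRightDescent x t) (hne : s ≠ t) : M s t = 2 := by
  by_contra h2
  obtain ⟨v, hv, hl⟩ := full_desc cs h4 (M_ge h4 hne h2) hs ht
  exact not_fc_dw cs h4 (M_ge h4 hne h2) (y := 1) (by simpa using hv) (by simpa using hl) h

theorem desc_p (h4 : SmallM M) {y : W} {s t : Fin n} (hs : cs.IsRightDescent y s)
    (ht : cs.IsRightDescent y t) (hm : M s t = 2) :
    cs.IsRightDescent (y * cs.simple s) t := by
  obtain ⟨v, hv, hl⟩ := two_desc cs h4 (ne_of_M (M := M) hm.ge) hs ht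
  have h1 : y * cs.simple s * cs.simple t = v := by
    rw [hv, mul_assoc v, simple_comm cs hm]; simp [← mul_assoc]
  rw [isRightDescent_iff] at hs
  unfold CoxeterSystem.IsRightDescent
  rw [h1]
  omega

theorem desc_q {x : W} {s r : Fin n} (hr : cs.IsRightDescent x r) (hm : M s r = 2)
    (hs : ¬ cs.IsRightDescent x s) : cs.IsRightDescent (x * cs.simple s) r := by
  rw [not_isRightDescent_iff] at hs
  rw [isRightDescent_iff] at hr
  unfold CoxeterSystem.IsRightDescent
  rw [mul_assoc, simple_comm cs hm, ← mul_assoc]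
  have := cs.length_mul_le (x * cs.simple r) (cs.simple s)
  rw [length_simple] at this
  omega

/-- A reduced word of a fully commutative element. -/
def FW (ω : List (Fin n)) : Prop := cs.IsReduced ω ∧ cs.FC (cs.wordProd ω)

theorem red_left {a b : List (Fin n)} (h : cs.IsReduced (a ++ b)) : cs.IsReduced a := by
  simpa using h.take a.length

theorem red_right {a b : List (Fin n)} (h : cs.IsReduced (a ++ b)) : cs.IsReduced b := by
  simpa using h.drop a.length

theorem fw_left {a b : List (Fin n)} (h : FW cs (a ++ b)) : FW cs a := by
  have h1 := red_left cs h.1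
  have h2 := red_right cs h.1
  refine ⟨h1, fc_left cs h.2 (wordProd_append _ _ _) ?_⟩
  rw [h.1.eq, h1.eq, h2.eq, List.length_append]

theorem red_concat {a : List (Fin n)} {s : Fin n} :
    cs.IsReduced (a ++ [s]) ↔ cs.IsReduced a ∧ ¬ cs.IsRightDescent (cs.wordProd a) s := by
  constructor
  · intro h
    have h1 := red_left cs h
    refine ⟨h1, ?_⟩
    rw [not_isRightDescent_iff, h1.eq]
    have := h.eq
    simpa [wordProd_append] using this
  · rintro ⟨h1, h2⟩
    rw [not_isRightDescent_iff, h1.eq] at h2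
    unfold CoxeterSystem.IsReduced
    simpa [wordProd_append] using h2

theorem desc_last {a : List (Fin n)} {s : Fin n} (h : cs.IsReduced (a ++ [s])) :
    cs.IsRightDescent (cs.wordProd (a ++ [s])) s := by
  rw [isRightDescent_iff]
  have h1 := red_left cs h
  rw [h.eq, wordProd_append]
  simp [h1.eq]

theorem indep_aux (h4 : SmallM M) : ∀ (N : ℕ) (ω ω' : List (Fin n)), ω.length = N → FW cs ω →
    cs.IsReduced ω' → cs.wordProd ω = cs.wordProd ω' → ω.Perm ω' ∧ bprod M ω = bprod M ω' := by
  intro N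
  induction N with
  | zero =>
    intro ω ω' hN hω hω' he
    have : ω'.length = 0 := by rw [← hω'.eq, ← he, hω.1.eq, hN]
    rw [List.length_eq_zero_iff] at hN this
    subst hN this
    exact ⟨List.Perm.refl _, rfl⟩
  | succ N ih =>
    intro ω ω' hN hω hω' he
    have hN' : ω'.length = N + 1 := by rw [← hω'.eq, ← he, hω.1.eq, hN]
    rcases List.eq_nil_or_concat' ω with rfl | ⟨α, s, rfl⟩
    · simp at hN
    rcases List.eq_nil_or_concat' ω' with rfl | ⟨β, t, rfl⟩
    · simp at hN'
    have hα := fw_left cs hω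
    have hβ := red_left cs hω'
    have lα : α.length = N := by simpa using hN
    have lβ : β.length = N := by simpa using hN'
    have es : cs.wordProd (α ++ [s]) * cs.simple s = cs.wordProd α := by simp [wordProd_append]
    have et : cs.wordProd (α ++ [s]) * cs.simple t = cs.wordProd β := by
      rw [he]; simp [wordProd_append]
    by_cases hst : s = t
    · subst hst
      obtain ⟨h1, h2⟩ := ih α β lα hα hβ (by rw [← es, et])
      exact ⟨h1.append_right _, by rw [bprod_append, h2, bprod_append]⟩
    · have ds := desc_last cs hω.1
      have dt := desc_last cs hω'
      rw [← he] at dt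
      have hm := n1 cs h4 hω.2 ds dt hst
      obtain ⟨v, hv, hl⟩ := two_desc cs h4 hst ds dt
      rw [hω.1.eq] at hl
      obtain ⟨γ, hγ, rfl⟩ := cs.exists_isReduced v
      rw [hγ.eq] at hl
      have e1 : cs.wordProd α = cs.wordProd (γ ++ [t]) := by
        rw [← es, hv, mul_assoc (cs.wordProd γ), simple_comm cs hm]
        simp [wordProd_append, ← mul_assoc]
      have e2 : cs.wordProd β = cs.wordProd (γ ++ [s]) := by
        rw [← et, hv]
        simp [wordProd_append, mul_assoc]
      have r1 : cs.IsReduced (γ ++ [t]) := by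
        unfold CoxeterSystem.IsReduced; rw [← e1, hα.1.eq]; simp at hl ⊢; omega
      have r2 : cs.IsReduced (γ ++ [s]) := by
        unfold CoxeterSystem.IsReduced; rw [← e2, hβ.eq]; simp at hl ⊢; omega
      have fβ : FW cs β := by
        have : FW cs (β ++ [t]) := ⟨hω', he ▸ hω.2⟩
        exact fw_left cs this
      obtain ⟨p1, b1⟩ := ih α _ lα hα r1 e1
      obtain ⟨p2, b2⟩ := ih β _ lβ fβ r2 e2
      constructor
      · refine (p1.append_right [s]).trans (List.Perm.trans ?_ (p2.append_right [t]).symm)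
        simp only [List.append_assoc]
        exact (List.Perm.swap _ _ _).append_left γ
      · rw [bprod_append, b1, bprod_append, bprod_append β, b2, bprod_append]
        simp only [bprod_cons, bprod_nil, mul_one, mul_assoc, bgen_comm hm]

theorem indep (h4 : SmallM M) {ω ω' : List (Fin n)} (h : FW cs ω)
    (h' : cs.IsReduced ω') (he : cs.wordProd ω = cs.wordProd ω') :
    ω.Perm ω' ∧ bprod M ω = bprod M ω' := indep_aux cs h4 _ ω ω' rfl h h' he

theorem braid_desc {x : W} {i j : Fin n} (hm : 3 ≤ M i j)
    {y : W} (hy : y = x * cs.wordProd (braidWord M i j))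
    (hl : cs.length y = cs.length x + M i j) : cs.IsRightDescent y j := by
  obtain ⟨k, hk⟩ : ∃ k, M i j = k + 1 := ⟨M i j - 1, by omega⟩
  have h1 : y * cs.simple j = x * cs.wordProd (alternatingWord j i k) := by
    rw [hy, braidWord, hk, alternatingWord_succ]
    simp [wordProd_append, mul_assoc]
  unfold CoxeterSystem.IsRightDescent
  rw [h1]
  have l1 := cs.length_mul_le x (cs.wordProd (alternatingWord j i k))
  have l2 := cs.length_wordProd_le (alternatingWord j i k)
  rw [length_alternatingWord] at l2
  omega

theorem claimC_aux (h4 : SmallM M) : ∀ (N : ℕ) (x : W) (s : Fin n), cs.length x = N → cs.FC x →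
    ¬ cs.IsRightDescent x s → ¬ cs.FC (x * cs.simple s) →
    ∃ (x1 : List (Fin n)) (t : Fin n) (x2 : List (Fin n)), 3 ≤ M s t ∧ (∀ r ∈ x2, M s r = 2) ∧
      x = cs.wordProd (x1 ++ dw M s t ++ [t] ++ x2) ∧
      cs.IsReduced (x1 ++ dw M s t ++ [t] ++ x2) := by
  intro N
  induction N with
  | zero =>
    intro x s hN hx hs hxs
    exfalso
    rw [not_isRightDescent_iff, hN] at hs
    apply hxs
    rintro ⟨a, b, i, j, hm, -, hl⟩
    omega
  | succ N ih =>
    intro x s hN hx hs hxs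
    have hly := (not_isRightDescent_iff cs).1 hs
    set y := x * cs.simple s with hy
    have hys : y * cs.simple s = x := by simp [hy]
    have ds : cs.IsRightDescent y s := by
      rw [isRightDescent_iff, hys, hly]
    by_cases hex : ∃ t, cs.IsRightDescent y t ∧ 3 ≤ M s t
    · obtain ⟨t, dt, hm⟩ := hex
      obtain ⟨v, hv, hl⟩ := full_desc cs h4 hm ds dt
      obtain ⟨x1, h1, rfl⟩ := cs.exists_isReduced v
      have e : x = cs.wordProd (x1 ++ dw M s t ++ [t] ++ []) := by
        rw [← hys, hv]; simp [wordProd_append, wordProd_cons, mul_assoc]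
      refine ⟨x1, t, [], hm, by simp, e, ?_⟩
      unfold CoxeterSystem.IsReduced
      rw [← e]
      rw [h1.eq] at hl
      simp at hl ⊢
      omega
    · push Not at hex
      have hcom : ∀ t, cs.IsRightDescent y t → t ≠ s → M s t = 2 := by
        intro t dt hne
        by_contra h2
        exact absurd (M_ge h4 (Ne.symm hne) h2) (by have := hex t dt; omega)
      unfold CoxeterSystem.FC at hxs
      rw [not_not] at hxs
      obtain ⟨a, b, i, j, hm, hyab, hlab⟩ := hxs
      by_cases hb : b = 1
      · exfalso
        subst hb
        simp only [mul_one, length_one, add_zero] at hyab hlab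
        have dj := braid_desc cs hm hyab hlab
        have hm' : 3 ≤ M j i := by rw [M.symmetric]; exact hm
        have di := braid_desc cs (i := j) (j := i) (x := a) (y := y) hm'
          (by rw [hyab, wordProd_braidWord_eq]) (by rw [hlab, M.symmetric j i])
        have his : i ≠ s := by
          rintro rfl; have := hex j dj; omega
        have hjs : j ≠ s := by
          rintro rfl; have := hex i di; omega
        have d1 := desc_p cs h4 ds di (hcom i di his)
        have d2 := desc_p cs h4 ds dj (hcom j dj hjs)
        rw [hys] at d1 d2
        have := n1 cs h4 hx d1 d2 (ne_of_M (M := M) (by omega))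
        omega
      · obtain ⟨p, hp⟩ := cs.exists_rightDescent_of_ne_one hb
        rw [isRightDescent_iff] at hp
        have hyp : y * cs.simple p = a * cs.wordProd (braidWord M i j) * (b * cs.simple p) := by
          rw [hyab, mul_assoc]
        have lyp : cs.length (y * cs.simple p) ≤
            cs.length a + M i j + cs.length (b * cs.simple p) := by
          rw [hyp]
          have l1 := cs.length_mul_le (a * cs.wordProd (braidWord M i j)) (b * cs.simple p)
          have l2 := cs.length_mul_le a (cs.wordProd (braidWord M i j))
          have l3 := cs.length_wordProd_le (braidWord M i j)
          rw [length_braidWord'] at l3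
          omega
        have dp : cs.IsRightDescent y p := by
          unfold CoxeterSystem.IsRightDescent; omega
        have hlyp := (isRightDescent_iff cs).1 dp
        have nyp : cs.IsComplexElt (y * cs.simple p) :=
          ⟨a, b * cs.simple p, i, j, hm, hyp, by omega⟩
        have hps : p ≠ s := by
          rintro rfl
          rw [hys] at nyp
          exact hx nyp
        have hc := hcom p dp hps
        have dxp := desc_p cs h4 ds dp hc
        rw [hys] at dxp
        have lz := (isRightDescent_iff cs).1 dxp
        have hzs : x * cs.simple p * cs.simple s = y * cs.simple p := by
          rw [mul_assoc, ← simple_comm cs hc, ← mul_assoc]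
        obtain ⟨x1, t, x2, h1, h2, h3, h5⟩ := ih (x * cs.simple p) s (by omega)
          (fc_left cs hx (u := x * cs.simple p) (b := cs.simple p) (by simp)
            (by rw [length_simple]; omega))
          (by rw [not_isRightDescent_iff, hzs]; omega)
          (by rw [hzs]; exact fun h => h nyp)
        have e : x = cs.wordProd (x1 ++ dw M s t ++ [t] ++ (x2 ++ [p])) := by
          rw [← List.append_assoc, wordProd_append, ← h3]; simp
        refine ⟨x1, t, x2 ++ [p], h1, ?_, e, ?_⟩
        · intro r hr
          simp at hr
          rcases hr with hr | rfl
          · exact h2 r hr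
          · exact hc
        · unfold CoxeterSystem.IsReduced
          rw [← e, ← List.append_assoc, List.length_append, ← h5.eq, ← h3]
          simp; omega

end FCpart

/-! ### Part 4: multiplying monomials by generators -/

section Mult

variable {n : ℕ} {M : CoxeterMatrix (Fin n)} (cs : CoxeterSystem M W)

theorem comb (a a' m m' : ℕ) (b : TL M) :
    a • (qc ^ m • (a' • (qc ^ m' • b))) = (a * a') • (qc ^ (m + m') • b) := by
  rw [smul_comm (qc ^ m) a', smul_smul, pow_add, smul_smul]

theorem comb_mul (a m : ℕ) (b c : TL M) :
    (a • (qc ^ m • b)) * c = a • (qc ^ m • (b * c)) := by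
  rw [smul_mul_assoc, smul_mul_assoc]

theorem fw_of_eq {ω ω' : List (Fin n)} (h : FW cs ω) (he : cs.wordProd ω' = cs.wordProd ω)
    (hl : ω'.length ≤ ω.length) : FW cs ω' := by
  refine ⟨?_, he ▸ h.2⟩
  unfold CoxeterSystem.IsReduced
  have := cs.length_wordProd_le ω'
  have h1 := h.1.eq
  rw [← he] at h1
  omega

theorem walk (h4 : SmallM M) {t : Fin n} {γ : List (Fin n)} : ∀ l : List (Fin n), FW cs (γ ++ l) →
    cs.IsRightDescent (cs.wordProd (γ ++ l)) t → (∀ r ∈ l, r ≠ t) →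
    cs.IsRightDescent (cs.wordProd γ) t ∧ ∀ r ∈ l, M t r = 2 := by
  intro l
  induction l using List.reverseRecOn with
  | nil => intro _ h _; simpa using h
  | append_singleton l p ih =>
    intro hF hR hl
    rw [← List.append_assoc] at hF hR
    have dp := desc_last cs hF.1
    have hm := n1 cs h4 hF.2 dp hR (hl p (by simp))
    have d1 := desc_p cs h4 dp hR hm
    have e : cs.wordProd (γ ++ l ++ [p]) * cs.simple p = cs.wordProd (γ ++ l) := by
      rw [wordProd_append _ (γ ++ l)]; simp
    rw [e] at d1
    obtain ⟨h1, h2⟩ := ih (fw_left cs hF) d1 (fun r hr => hl r (by simp [hr]))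
    refine ⟨h1, ?_⟩
    intro r hr
    simp at hr
    rcases hr with hr | rfl
    · exact h2 r hr
    · rw [M.symmetric]; exact hm

theorem walkchain (h4 : SmallM M) {r : Fin n} {γ : List (Fin n)} : ∀ l : List (Fin n),
    FW cs (γ ++ l) → List.IsChain (fun a b => 3 ≤ M a b) l →
    cs.IsRightDescent (cs.wordProd (γ ++ l)) r →
    (∃ l', l = l' ++ [r]) ∨
    (cs.IsRightDescent (cs.wordProd γ) r ∧ ∀ q ∈ l, M q r = 2) := by
  intro l
  induction l using List.reverseRecOn with
  | nil => intro _ _ h; right; simpa using h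
  | append_singleton l p ih =>
    intro hF hC hR
    by_cases hpr : p = r
    · subst hpr; left; exact ⟨l, rfl⟩
    right
    rw [← List.append_assoc] at hF hR
    have dp := desc_last cs hF.1
    have hm := n1 cs h4 hF.2 dp hR hpr
    have d1 := desc_p cs h4 dp hR hm
    have e : cs.wordProd (γ ++ l ++ [p]) * cs.simple p = cs.wordProd (γ ++ l) := by
      rw [wordProd_append _ (γ ++ l)]; simp
    rw [e] at d1
    rcases ih (fw_left cs hF) (hC.left_of_append) d1 with ⟨l', rfl⟩ | ⟨h1, h2⟩
    · exfalso
      rw [List.append_assoc] at hC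
      have := hC.right_of_append
      simp at this
      rw [M.symmetric] at this
      omega
    · refine ⟨h1, ?_⟩
      intro q hq
      simp at hq
      rcases hq with hq | rfl
      · exact h2 q hq
      · exact hm

theorem exists_last {x : W} {s : Fin n} (h : cs.IsRightDescent x s) :
    ∃ ω, x = cs.wordProd (ω ++ [s]) ∧ cs.IsReduced (ω ++ [s]) := by
  obtain ⟨ω, h1, h2⟩ := cs.exists_isReduced (x * cs.simple s)
  have e : x = cs.wordProd (ω ++ [s]) := by rw [wordProd_append, ← h2]; simp
  refine ⟨ω, e, ?_⟩
  rw [red_concat]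
  refine ⟨h1, ?_⟩
  rw [← h2, not_isRightDescent_iff]
  rw [isRightDescent_iff] at h
  simp [h]

/-- Removing `t` after the dihedral word. -/
theorem desc_dw {x1 g : List (Fin n)} {s t : Fin n}
    (hs : ∀ r ∈ g, M s r = 2) (hr : cs.IsReduced (x1 ++ dw M s t ++ g)) :
    cs.IsRightDescent (cs.wordProd (x1 ++ dw M s t ++ g)) s := by
  obtain ⟨l, hl⟩ := dw_last (M := M) s t
  have e : cs.wordProd (x1 ++ dw M s t ++ g) * cs.simple s = cs.wordProd (x1 ++ l ++ g) := by
    rw [hl]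
    simp only [wordProd_append, mul_assoc]
    rw [← word_comm cs hs]
    simp
  unfold CoxeterSystem.IsRightDescent
  rw [e, hr.eq]
  have := cs.length_wordProd_le (x1 ++ l ++ g)
  rw [hl]
  simp at *
  omega

theorem alg_dw (h4 : SmallM M) {s t : Fin n} (hm : 3 ≤ M s t) (x1 g : List (Fin n))
    (hs : ∀ r ∈ g, M s r = 2) (ht : ∀ r ∈ g, M t r = 2) :
    ∃ a : ℕ, bprod M (x1 ++ dw M s t ++ g) * bgen M t * bgen M s =
      a • bprod M (x1 ++ dw M s t ++ g) := by
  obtain ⟨a, ha⟩ := dw_alg h4 hm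
  refine ⟨a, ?_⟩
  rw [bprod_append, mul_assoc _ (bprod M g), ← bprod_comm ht, ← mul_assoc, mul_assoc _ (bprod M g),
    ← bprod_comm hs, ← mul_assoc, bprod_append, mul_assoc (bprod M x1), mul_assoc (bprod M x1), ha,
    mul_smul_comm, smul_mul_assoc]

theorem fw_concat {ω : List (Fin n)} {s : Fin n} (hF : FW cs ω)
    (hs : ¬ cs.IsRightDescent (cs.wordProd ω) s) (hfc : cs.FC (cs.wordProd ω * cs.simple s)) :
    FW cs (ω ++ [s]) :=
  ⟨(red_concat cs).2 ⟨hF.1, hs⟩, by rw [wordProd_append]; simpa using hfc⟩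

theorem l3 (h4 : SmallM M) {ω : List (Fin n)} {s : Fin n} (hF : FW cs ω) (hs : s ∉ ω) :
    FW cs (ω ++ [s]) := by
  have hd : ¬ cs.IsRightDescent (cs.wordProd ω) s := by
    intro h
    obtain ⟨ω', h1, h2⟩ := exists_last cs h
    have := (indep cs h4 hF h2 h1).1
    exact hs (this.mem_iff.2 (by simp))
  refine fw_concat cs hF hd ?_
  by_contra hfc
  obtain ⟨x1, t, x2, h1, h2, h3, h5⟩ := claimC_aux cs h4 _ _ s rfl hF.2 hd hfc
  have := (indep cs h4 hF h5 h3).1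
  exact hs (this.mem_iff.2 (by simp [s_mem_dw]))

theorem l1 (h4 : SmallM M) {ω : List (Fin n)} {s t : Fin n} (hF : FW cs ω)
    (ht : cs.IsRightDescent (cs.wordProd ω) t) (hm : 3 ≤ M s t) :
    ∃ (a : ℕ) (ω' : List (Fin n)), FW cs ω' ∧ ω' ⊆ s :: ω ∧
      bprod M ω * bgen M s = a • bprod M ω' ∧ cs.IsRightDescent (cs.wordProd ω') s ∧
      ∀ r, cs.IsRightDescent (cs.wordProd ω) r → M s r = 2 →
        cs.IsRightDescent (cs.wordProd ω') r := by
  have hne : s ≠ t := ne_of_M (M := M) (by omega)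
  have hd : ¬ cs.IsRightDescent (cs.wordProd ω) s := by
    intro h
    have := n1 cs h4 hF.2 h ht hne
    omega
  by_cases hfc : cs.FC (cs.wordProd ω * cs.simple s)
  · have hF' := fw_concat cs hF hd hfc
    refine ⟨1, ω ++ [s], hF', by intro q hq; simp at hq ⊢; tauto, ?_, desc_last cs hF'.1, ?_⟩
    · rw [bprod_append, one_smul]; simp [bprod]
    · intro r hr hsr
      have := desc_q cs hr hsr hd
      rw [wordProd_append]; simpa using this
  · obtain ⟨x1, u, x2, h1, h2, h3, h5⟩ := claimC_aux cs h4 _ _ s rfl hF.2 hd hfc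
    obtain ⟨hp, hb⟩ := indep cs h4 hF h5 h3
    have hF0 : FW cs (x1 ++ dw M s u ++ [u] ++ x2) := ⟨h5, h3 ▸ hF.2⟩
    have ht' := ht
    rw [h3] at ht'
    obtain ⟨w1, w2⟩ := walk cs h4 x2 hF0 ht' (by
      rintro r hr rfl; have := h2 r hr; omega)
    have hF1 := fw_left cs hF0
    have htu : t = u := by
      by_contra htu
      have du := desc_last cs hF1.1
      have hm2 := n1 cs h4 hF1.2 du w1 (Ne.symm htu)
      have d1 := desc_p cs h4 du w1 hm2
      have e : cs.wordProd (x1 ++ dw M s u ++ [u]) * cs.simple u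
          = cs.wordProd (x1 ++ dw M s u) := by
        rw [wordProd_append _ (x1 ++ _)]; simp
      rw [e] at d1
      have hF2 := fw_left cs hF1
      have d2 := desc_dw cs (x1 := x1) (g := []) (s := s) (t := u) (by simp) (by simpa using hF2.1)
      rw [List.append_nil] at d2
      have := n1 cs h4 hF2.2 d2 d1 hne
      omega
    subst htu
    obtain ⟨a, ha⟩ := alg_dw h4 hm x1 x2 h2 w2
    have e1 : cs.wordProd ω * cs.simple t = cs.wordProd (x1 ++ dw M s t ++ x2) := by
      rw [h3]
      simp only [wordProd_append, mul_assoc]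
      rw [← word_comm cs w2]
      simp
    have hlt := (isRightDescent_iff cs).1 ht
    have hFω : FW cs (x1 ++ dw M s t ++ x2) := by
      have hl2 := h5.eq
      rw [← h3] at hl2
      simp at hl2
      refine ⟨?_, ?_⟩
      · unfold CoxeterSystem.IsReduced
        rw [← e1]
        simp
        omega
      · rw [← e1]
        refine fc_left cs hF.2 (b := cs.simple t) (by simp) (by simpa using hlt.symm)
    refine ⟨a, x1 ++ dw M s t ++ x2, hFω, ?_, ?_, desc_dw cs h2 hFω.1, ?_⟩
    · intro q hq
      refine List.mem_cons_of_mem _ (hp.mem_iff.2 ?_)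
      simp at hq ⊢
      tauto
    · rw [← ha, hb]
      congr 1
      rw [bprod_append, bprod_append (x1 ++ _), mul_assoc, bprod_append (x1 ++ _), mul_assoc]
      congr 1
      rw [← bprod_comm w2]; simp [bprod]
    · intro r hr hsr
      rw [← e1]
      have htr : t ≠ r := by rintro rfl; omega
      exact desc_p cs h4 ht hr (n1 cs h4 hF.2 ht hr htr)

theorem iter (h4 : SmallM M) : ∀ (l : List (Fin n)) (p : Fin n) (ω : List (Fin n)), FW cs ω →
    cs.IsRightDescent (cs.wordProd ω) p → List.IsChain (fun a b => 3 ≤ M a b) (p :: l) →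
    ∃ (a : ℕ) (ω' : List (Fin n)), FW cs ω' ∧ ω' ⊆ ω ++ l ∧
      bprod M ω * bprod M l = a • bprod M ω' ∧
      (∀ r, (∃ l', p :: l = l' ++ [r]) → cs.IsRightDescent (cs.wordProd ω') r) ∧
      ∀ r, cs.IsRightDescent (cs.wordProd ω) r → (∀ q ∈ l, M q r = 2) →
        cs.IsRightDescent (cs.wordProd ω') r := by
  intro l
  induction l with
  | nil =>
    intro p ω hF hp hC
    refine ⟨1, ω, hF, by simp, by simp [bprod], ?_, fun r hr _ => hr⟩
    rintro r ⟨l', hl'⟩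
    have : p = r := by
      rcases l' with _ | ⟨b, l'⟩
      · simpa using hl'
      · simp at hl'
    exact this ▸ hp
  | cons q l ih =>
    intro p ω hF hp hC
    rw [List.isChain_cons_cons] at hC
    obtain ⟨a, ω1, f1, s1, b1, r1, q1⟩ := l1 cs h4 (s := q) hF hp (by rw [M.symmetric]; exact hC.1)
    obtain ⟨a2, ω2, f2, s2, b2, r2, q2⟩ := ih q ω1 f1 r1 hC.2
    refine ⟨a * a2, ω2, f2, ?_, ?_, ?_, ?_⟩
    · intro z hz
      have := s2 hz
      simp at this ⊢
      rcases this with h | h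
      · have := s1 h
        simp at this
        tauto
      · tauto
    · rw [bprod_cons, ← mul_assoc, b1, smul_mul_assoc, b2, smul_smul]
    · rintro r ⟨l', hl'⟩
      rcases l' with _ | ⟨b, l'⟩
      · simp at hl'
      · simp at hl'
        exact r2 r ⟨l', hl'.2⟩
    · intro r hr hall
      exact q2 r (q1 r hr (hall q (by simp))) (fun z hz => hall z (by simp [hz]))

/-- The normal-form property for words commuting with `s`, relative to a neighbour `t`. -/
def SideP : Prop := ∀ (s t : Fin n) (x2 : List (Fin n)), 3 ≤ M s t → (∀ r ∈ x2, M s r = 2) →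
  ∃ g l : List (Fin n), cs.wordProd x2 = cs.wordProd (g ++ l) ∧ g.length + l.length ≤ x2.length ∧
    (∀ r ∈ g, M s r = 2 ∧ M t r = 2) ∧ (∀ r ∈ l, M s r = 2) ∧
    List.IsChain (fun a b => 3 ≤ M a b) (t :: l)

theorem l2_aux (h4 : SmallM M) (hS : SideP cs) : ∀ (N : ℕ) (ω : List (Fin n)) (s : Fin n),
    ω.length = N → FW cs ω →
    ∃ (a m : ℕ) (ω' : List (Fin n)), m ≤ 1 ∧ FW cs ω' ∧ ω' ⊆ s :: ω ∧
      bprod M ω * bgen M s = a • (qc ^ m • bprod M ω') ∧ cs.IsRightDescent (cs.wordProd ω') s ∧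
      ∀ r, cs.IsRightDescent (cs.wordProd ω) r → M s r = 2 →
        cs.IsRightDescent (cs.wordProd ω') r := by
  intro N
  induction N using Nat.strong_induction_on with
  | _ N ih =>
  intro ω s hN hF
  by_cases hd : cs.IsRightDescent (cs.wordProd ω) s
  · obtain ⟨ω0, h1, h2⟩ := exists_last cs hd
    have hb := (indep cs h4 hF h2 h1).2
    refine ⟨1, 1, ω, le_rfl, hF, by simp, ?_, hd, fun r hr _ => hr⟩
    rw [hb, bprod_append, bprod_cons, bprod_nil, mul_one, mul_assoc, bgen_sq, mul_smul_comm,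
      one_smul, pow_one]
  by_cases hfc : cs.FC (cs.wordProd ω * cs.simple s)
  · have hF' := fw_concat cs hF hd hfc
    refine ⟨1, 0, ω ++ [s], by omega, hF', by intro q hq; simp at hq ⊢; tauto, ?_,
      desc_last cs hF'.1, ?_⟩
    · rw [bprod_append, one_smul, pow_zero, one_smul]; simp [bprod]
    · intro r hr hsr
      have := desc_q cs hr hsr hd
      rw [wordProd_append]; simpa using this
  obtain ⟨x1, t, x2, h1, h2, h3, h5⟩ := claimC_aux cs h4 _ _ s rfl hF.2 hd hfc
  obtain ⟨g, l, e1, ll, hg, hl, hch⟩ := hS s t x2 h1 h2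
  have hgs : ∀ r ∈ g, M s r = 2 := fun r hr => (hg r hr).1
  have hgt : ∀ r ∈ g, M t r = 2 := fun r hr => (hg r hr).2
  have e2 : cs.wordProd ((x1 ++ dw M s t ++ g) ++ (t :: l)) = cs.wordProd ω := by
    rw [h3, wordProd_append _ _ x2, e1]
    simp only [wordProd_append, wordProd_cons, wordProd_nil, mul_assoc, one_mul]
    rw [← mul_assoc (cs.wordProd g), ← word_comm cs hgt]
    simp only [mul_assoc]
  have len : ((x1 ++ dw M s t ++ g) ++ (t :: l)).length ≤ ω.length := by
    have := h5.eq
    rw [← h3, hF.1.eq] at this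
    rw [this]
    simp
    omega
  have hF2 := fw_of_eq cs hF e2 len
  obtain ⟨hp, hb⟩ := indep cs h4 hF hF2.1 e2.symm
  set v := x1 ++ dw M s t ++ g with hv
  have hFv : FW cs v := fw_left cs hF2
  have dvs : cs.IsRightDescent (cs.wordProd v) s := desc_dw cs hgs hFv.1
  obtain ⟨a, ha⟩ := alg_dw h4 h1 x1 g hgs hgt
  rw [← hv] at ha
  have hprod : bprod M ω * bgen M s = a • (bprod M v * bprod M l) := by
    rw [hb, bprod_append, bprod_cons, mul_assoc, mul_assoc, ← bprod_comm hl, ← mul_assoc,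
      ← mul_assoc, ha, smul_mul_assoc]
  have hpres : ∀ r, cs.IsRightDescent (cs.wordProd ω) r →
      (∃ l', t :: l = l' ++ [r]) ∨
      (cs.IsRightDescent (cs.wordProd v) r ∧ ∀ q ∈ t :: l, M q r = 2) := by
    intro r hr
    rw [← e2] at hr
    exact walkchain cs h4 (t :: l) hF2 hch hr
  have hsub : v ++ t :: l ⊆ ω := hp.symm.subset
  rcases l with _ | ⟨p, l⟩
  · refine ⟨a, 0, v, by omega, hFv, ?_, by simpa [bprod] using hprod, dvs, ?_⟩
    · intro q hq
      right
      exact hsub (by simp [hq])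
    · intro r hr hsr
      rcases hpres r hr with ⟨l', hl'⟩ | ⟨h, -⟩
      · exfalso
        rcases l' with _ | ⟨b, l'⟩
        · simp at hl'
          subst hl'
          omega
        · simp at hl'
      · exact h
  · have lv : v.length < N := by
      simp only [List.length_append, List.length_cons] at len; omega
    obtain ⟨a1, m1, ω1, hm1, f1, s1, b1, r1, q1⟩ := ih _ lv v p rfl hFv
    rw [List.isChain_cons_cons] at hch
    obtain ⟨a2, ω2, f2, s2, b2, r2, q2⟩ := iter cs h4 l p ω1 f1 r1 hch.2
    refine ⟨a * (a1 * a2), m1, ω2, hm1, f2, ?_, ?_, ?_, ?_⟩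
    · intro z hz
      right
      apply hsub
      have := s2 hz
      simp at this ⊢
      rcases this with h | h
      · have := s1 h
        simp at this
        tauto
      · tauto
    · rw [hprod, bprod_cons, ← mul_assoc, b1, comb_mul, b2, ← smul_smul, ← smul_smul,
        smul_comm (qc ^ m1) a2]
    · refine q2 s (q1 s dvs ?_) ?_
      · rw [M.symmetric]; exact hl p (by simp)
      · intro q hq
        rw [M.symmetric]; exact hl q (by simp [hq])
    · intro r hr hsr
      rcases hpres r hr with ⟨l', hl'⟩ | ⟨h, hq⟩
      · rcases l' with _ | ⟨b, l'⟩
        · simp at hl'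
        · simp only [List.cons_append, List.cons.injEq] at hl'
          exact r2 r ⟨l', hl'.2⟩
      · exact q2 r (q1 r h (hq p (by simp))) (fun q hq' => hq q (by simp [hq']))

theorem l2 (h4 : SmallM M) (hS : SideP cs) {ω : List (Fin n)} (s : Fin n) (hF : FW cs ω) :
    ∃ (a m : ℕ) (ω' : List (Fin n)), m ≤ 1 ∧ FW cs ω' ∧ ω' ⊆ s :: ω ∧
      bprod M ω * bgen M s = a • (qc ^ m • bprod M ω') ∧
      cs.IsRightDescent (cs.wordProd ω') s := by
  obtain ⟨a, m, ω', h1, h2, h3, h5, h6, -⟩ := l2_aux cs h4 hS _ ω s rfl hF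
  exact ⟨a, m, ω', h1, h2, h3, h5, h6⟩

theorem run (h4 : SmallM M) (hS : SideP cs) : ∀ l : List (Fin n),
    (∀ κ ω : List (Fin n), FW cs ω → List.IsChain (fun a b => 3 ≤ M a b) l → κ.Sublist l →
      ∃ (a m : ℕ) (ω' : List (Fin n)), FW cs ω' ∧ ω' ⊆ ω ++ κ ∧
        bprod M ω * bprod M κ = a • (qc ^ m • bprod M ω') ∧ m + κ.length ≤ l.length + 1) ∧
    (∀ (κ ω : List (Fin n)) (t : Fin n), FW cs ω → cs.IsRightDescent (cs.wordProd ω) t →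
      List.IsChain (fun a b => 3 ≤ M a b) (t :: l) → κ.Sublist l →
      ∃ (a m : ℕ) (ω' : List (Fin n)), FW cs ω' ∧ ω' ⊆ ω ++ κ ∧
        bprod M ω * bprod M κ = a • (qc ^ m • bprod M ω') ∧ m + κ.length ≤ l.length) := by
  intro l
  induction l with
  | nil =>
    constructor
    · intro κ ω hF _ hκ
      rw [List.sublist_nil] at hκ
      subst hκ
      exact ⟨1, 0, ω, hF, by simp, by simp [bprod], by simp⟩
    · intro κ ω t hF _ _ hκ
      rw [List.sublist_nil] at hκ
      subst hκ
      exact ⟨1, 0, ω, hF, by simp, by simp [bprod], by simp⟩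
  | cons p l ih =>
    obtain ⟨ih0, ih1⟩ := ih
    constructor
    · intro κ ω hF hC hκ
      rcases List.sublist_cons_iff.1 hκ with hκ' | ⟨κ', rfl, hκ'⟩
      · obtain ⟨a, m, ω', h1, h2, h3, h5⟩ := ih0 κ ω hF hC.tail hκ'
        exact ⟨a, m, ω', h1, h2, h3, by simp; omega⟩
      · obtain ⟨a, m, ω1, hm, f1, s1, b1, r1⟩ := l2 cs h4 hS p hF
        obtain ⟨a2, m2, ω2, f2, s2, b2, hm2⟩ := ih1 κ' ω1 p f1 r1 hC hκ'
        refine ⟨a * a2, m + m2, ω2, f2, ?_, ?_, by simp; omega⟩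
        · intro z hz
          have := s2 hz
          simp at this ⊢
          rcases this with h | h
          · have := s1 h
            simp at this
            tauto
          · tauto
        · rw [bprod_cons, ← mul_assoc, b1, comb_mul, b2, comb]
    · intro κ ω t hF ht hC hκ
      rw [List.isChain_cons_cons] at hC
      rcases List.sublist_cons_iff.1 hκ with hκ' | ⟨κ', rfl, hκ'⟩
      · obtain ⟨a, m, ω', h1, h2, h3, h5⟩ := ih0 κ ω hF hC.2.tail hκ'
        exact ⟨a, m, ω', h1, h2, h3, by simp; omega⟩
      · obtain ⟨a, ω1, f1, s1, b1, r1, -⟩ := l1 cs h4 (s := p) hF ht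
          (by rw [M.symmetric]; exact hC.1)
        obtain ⟨a2, m2, ω2, f2, s2, b2, hm2⟩ := ih1 κ' ω1 p f1 r1 hC.2 hκ'
        refine ⟨a * a2, m2, ω2, f2, ?_, ?_, by simp; omega⟩
        · intro z hz
          have := s2 hz
          simp at this ⊢
          rcases this with h | h
          · have := s1 h
            simp at this
            tauto
          · tauto
        · rw [bprod_cons, ← mul_assoc, b1, smul_mul_assoc, b2, smul_smul]

end Mult

/-! ### Part 5: chains and coset normal forms -/

section Chains

variable {n : ℕ} {M : CoxeterMatrix (Fin n)} (cs : CoxeterSystem M W)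

/-- `c` lists the vertices of a path graph, with last bond `4` when `β` holds. -/
def Ch (M : CoxeterMatrix (Fin n)) (β : Prop) : List (Fin n) → Prop
  | [] => True
  | [_] => True
  | a :: b :: c => ((β ∧ c = [] ∧ M a b = 4) ∨ (¬ (β ∧ c = []) ∧ M a b = 3)) ∧
      (∀ x ∈ c, M a x = 2) ∧ Ch M β (b :: c)

/-- The palindromic word going along the path and back. -/
def fullW : List (Fin n) → List (Fin n)
  | [] => []
  | [a] => [a]
  | a :: b :: c => a :: (fullW (b :: c) ++ [a])

/-- Words of minimal coset representatives. -/
inductive Pth (β : Prop) : List (Fin n) → List (Fin n) → Prop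
  | nil (c) : Pth β c []
  | cons (a c p) : Pth β c p → Pth β (a :: c) (a :: p)
  | full (a b c) : β → Pth β (a :: b :: c) (a :: (fullW (b :: c) ++ [a]))

theorem ch_tail {β : Prop} {a : Fin n} {c : List (Fin n)} (h : Ch M β (a :: c)) : Ch M β c := by
  rcases c with _ | ⟨b, c⟩
  · trivial
  · exact h.2.2

theorem ch_ge {β : Prop} {a b : Fin n} {c : List (Fin n)} (h : Ch M β (a :: b :: c)) :
    3 ≤ M a b := by
  have := h.1
  omega

theorem ch_not_mem {β : Prop} {a : Fin n} {c : List (Fin n)} (h : Ch M β (a :: c)) : a ∉ c := by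
  rcases c with _ | ⟨b, c⟩
  · simp
  · intro hm
    rcases List.mem_cons.1 hm with rfl | hm
    · have := ch_ge h
      rw [M_eq_one.2 rfl] at this
      omega
    · have := h.2.1 _ hm
      rw [M_eq_one.2 rfl] at this
      omega

theorem full_head (b : Fin n) (c : List (Fin n)) : ∃ l, fullW (b :: c) = b :: l := by
  rcases c with _ | ⟨d, c⟩
  · exact ⟨[], rfl⟩
  · exact ⟨_, rfl⟩

theorem full_last (b : Fin n) (c : List (Fin n)) : ∃ l, fullW (b :: c) = l ++ [b] := by
  rcases c with _ | ⟨d, c⟩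
  · exact ⟨[], rfl⟩
  · exact ⟨b :: fullW (d :: c), rfl⟩

theorem full_sub : ∀ c : List (Fin n), fullW c ⊆ c
  | [] => by simp [fullW]
  | [a] => by simp [fullW]
  | a :: b :: c => by
    intro x hx
    have ih := full_sub (b :: c)
    simp only [fullW, List.mem_cons, List.mem_append, List.not_mem_nil, or_false] at hx
    rcases hx with rfl | hx | rfl
    · simp
    · exact List.mem_cons_of_mem _ (ih hx)
    · simp

theorem full_chain {β : Prop} : ∀ c : List (Fin n), Ch M β c →
    List.IsChain (fun a b => 3 ≤ M a b) (fullW c)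
  | [], _ => by simp [fullW]
  | [a], _ => by simp [fullW]
  | a :: b :: c, h => by
    have ih := full_chain (b :: c) (ch_tail h)
    have hab := ch_ge h
    obtain ⟨l, hl⟩ := full_head b c
    obtain ⟨l', hl'⟩ := full_last b c
    have h1 : List.IsChain (fun a b => 3 ≤ M a b) (fullW (b :: c) ++ [a]) := by
      rw [List.isChain_append]
      refine ⟨ih, by simp, ?_⟩
      rw [hl']
      intro x hx y hy
      simp at hx hy
      subst hx hy
      rw [M.symmetric]
      exact hab
    simp only [fullW]
    rw [hl] at h1 ⊢
    rw [List.cons_append] at h1 ⊢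
    rw [List.isChain_cons_cons]
    exact ⟨hab, h1⟩

theorem pth_sub {β : Prop} {c p : List (Fin n)} (h : Pth β c p) : p ⊆ c := by
  induction h with
  | nil c => simp
  | cons a c p _ ih =>
    intro x hx
    rcases List.mem_cons.1 hx with rfl | hx
    · simp
    · exact List.mem_cons_of_mem _ (ih hx)
  | full a b c _ => exact full_sub (a :: b :: c)

theorem pth_head {β : Prop} {c : List (Fin n)} {x : Fin n} {p : List (Fin n)}
    (h : Pth β c (x :: p)) : ∃ c', c = x :: c' := by
  cases h with
  | cons c _ => exact ⟨_, rfl⟩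
  | full b c _ => exact ⟨_, rfl⟩

theorem pth_chain {β : Prop} {c p : List (Fin n)} (h : Pth β c p) (hc : Ch M β c) :
    List.IsChain (fun a b => 3 ≤ M a b) p := by
  induction h with
  | nil c => simp
  | cons a c p h ih =>
    have h1 := ih (ch_tail hc)
    rcases p with _ | ⟨b, p⟩
    · simp
    · obtain ⟨c', rfl⟩ := pth_head h
      rw [List.isChain_cons_cons]
      exact ⟨ch_ge hc, h1⟩
  | full a b c _ => exact full_chain (a :: b :: c) hc

theorem pth_full {β : Prop} (hβ : β) : ∀ c : List (Fin n), Pth β c (fullW c)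
  | [] => Pth.nil _
  | [a] => Pth.cons a [] [] (Pth.nil _)
  | a :: b :: c => Pth.full a b c hβ

theorem braid3 {a b : Fin n} (h : M a b = 3) :
    cs.simple a * (cs.simple b * cs.simple a) = cs.simple b * (cs.simple a * cs.simple b) := by
  have := cs.wordProd_braidWord_eq a b
  rw [braidWord, braidWord, M.symmetric b a, h] at this
  simpa [alternatingWord, wordProd_cons] using this.symm

theorem braid4 {a b : Fin n} (h : M a b = 4) :
    cs.simple a * (cs.simple b * (cs.simple a * cs.simple b)) =
      cs.simple b * (cs.simple a * (cs.simple b * cs.simple a)) := by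
  have := cs.wordProd_braidWord_eq a b
  rw [braidWord, braidWord, M.symmetric b a, h] at this
  simpa [alternatingWord, wordProd_cons] using this

theorem full_comm {β : Prop} (hβ : β) : ∀ (c : List (Fin n)) (a : Fin n), Ch M β (a :: c) →
    ∀ r ∈ c, cs.wordProd (fullW (a :: c)) * cs.simple r =
      cs.simple r * cs.wordProd (fullW (a :: c))
  | [], a, _ => by simp
  | b :: c, a, h => by
    intro r hr
    have ih := full_comm hβ c b (ch_tail h)
    have e : cs.wordProd (fullW (a :: b :: c)) =
        cs.simple a * (cs.wordProd (fullW (b :: c)) * cs.simple a) := by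
      simp [fullW, wordProd_cons, wordProd_append]
    rcases List.mem_cons.1 hr with rfl | hr
    · rcases c with _ | ⟨d, c⟩
      · have h1 : M a r = 4 := by
          rcases h.1 with h | h
          · exact h.2.2
          · exact absurd ⟨hβ, rfl⟩ h.1
        rw [e]
        simp only [fullW, wordProd_singleton, mul_assoc]
        exact braid4 cs h1
      · have h1 : M a r = 3 := by
          rcases h.1 with h | h
          · simp at h
          · exact h.2
        have hF : cs.simple a * cs.wordProd (fullW (d :: c)) =
            cs.wordProd (fullW (d :: c)) * cs.simple a :=
          word_comm cs (fun x hx => h.2.1 x (full_sub _ hx))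
        rw [e]
        have e2 : cs.wordProd (fullW (r :: d :: c)) =
            cs.simple r * (cs.wordProd (fullW (d :: c)) * cs.simple r) := by
          simp [fullW, wordProd_cons, wordProd_append]
        rw [e2]
        generalize cs.wordProd (fullW (d :: c)) = F at *
        have b3 := braid3 cs h1
        simp only [mul_assoc]
        rw [← b3, ← mul_assoc F, ← hF]
        simp only [← mul_assoc] at b3 ⊢
        rw [b3]
    · have hra : M r a = 2 := by rw [M.symmetric]; exact h.2.1 r hr
      rw [e]
      have h1 := ih r hr
      have h2 := simple_comm cs hra
      simp only [mul_assoc]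
      rw [← h2, ← mul_assoc _ (cs.simple r), h1, ← mul_assoc (cs.simple r) (cs.simple a), h2]
      simp only [mul_assoc]

theorem step {β : Prop} {c p : List (Fin n)} (h : Pth β c p) (hc : Ch M β c) {r : Fin n}
    (hr : r ∈ c) :
    (∃ p', Pth β c p' ∧ cs.wordProd p * cs.simple r = cs.wordProd p' ∧ p'.length ≤ p.length + 1) ∨
    (∃ r' ∈ c.tail, cs.wordProd p * cs.simple r = cs.simple r' * cs.wordProd p) := by
  induction h with
  | nil c =>
    rcases c with _ | ⟨a, c⟩
    · simp at hr
    rcases List.mem_cons.1 hr with rfl | hr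
    · left
      exact ⟨[r], Pth.cons _ _ _ (Pth.nil _), by simp, by simp⟩
    · right
      exact ⟨r, hr, by simp⟩
  | cons a c p h ih =>
    rcases List.mem_cons.1 hr with rfl | hr
    · rcases p with _ | ⟨b, p⟩
      · left
        exact ⟨[], Pth.nil _, by simp, by simp⟩
      · cases h with
        | cons _ c _ h =>
          by_cases h3 : M r b = 3
          · right
            refine ⟨b, by simp, ?_⟩
            have b3 := braid3 cs h3
            have hp : cs.simple r * cs.wordProd p = cs.wordProd p * cs.simple r :=
              word_comm cs (fun x hx => hc.2.1 x (pth_sub h hx))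
            simp only [wordProd_cons, mul_assoc]
            rw [← hp]
            simp only [← mul_assoc] at b3 ⊢
            rw [b3]
          · have hb : β ∧ c = [] := by
              rcases hc.1 with h | h
              · exact ⟨h.1, h.2.1⟩
              · exact absurd h.2 h3
            obtain ⟨hβ, rfl⟩ := hb
            have hp := List.subset_nil.1 (pth_sub h)
            subst hp
            left
            exact ⟨_, Pth.full r b [] hβ, by simp [fullW, wordProd_cons, mul_assoc], by simp [fullW]⟩
        | full _ d c hβ =>
          left
          refine ⟨_, Pth.full r b (d :: c) hβ, ?_, by simp [fullW]⟩
          simp [fullW, wordProd_cons, wordProd_append, mul_assoc]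
    · rcases ih (ch_tail hc) hr with ⟨p', h1, h2, h3⟩ | ⟨r', h1, h2⟩
      · left
        refine ⟨a :: p', Pth.cons _ _ _ h1, ?_, by simpa using h3⟩
        rw [wordProd_cons, mul_assoc, h2, wordProd_cons]
      · right
        refine ⟨r', List.mem_of_mem_tail h1, ?_⟩
        have har : M a r' = 2 := by
          rcases c with _ | ⟨b, c⟩
          · simp at h1
          · exact hc.2.1 r' h1
        rw [wordProd_cons, mul_assoc, h2, ← mul_assoc, simple_comm cs har, mul_assoc]
  | full a b c hβ =>
    rcases List.mem_cons.1 hr with rfl | hr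
    · left
      refine ⟨r :: fullW (b :: c), Pth.cons _ _ _ (pth_full hβ _), ?_, by simp⟩
      simp [wordProd_cons, wordProd_append, mul_assoc]
    · right
      exact ⟨r, hr, full_comm cs hβ (b :: c) a hc r hr⟩

theorem nform {β : Prop} {c : List (Fin n)} (hc : Ch M β c) : ∀ x : List (Fin n), x ⊆ c →
    ∃ h p, h ⊆ c.tail ∧ Pth β c p ∧ cs.wordProd x = cs.wordProd (h ++ p) ∧
      h.length + p.length ≤ x.length := by
  intro x
  induction x using List.reverseRecOn with
  | nil => intro _; exact ⟨[], [], by simp, Pth.nil _, by simp, by simp⟩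
  | append_singleton x r ih =>
    intro hx
    obtain ⟨h, p, h1, h2, h3, h5⟩ := ih (fun z hz => hx (by simp [hz]))
    rcases step cs h2 hc (r := r) (hx (by simp)) with ⟨p', q1, q2, q3⟩ | ⟨r', q1, q2⟩
    · refine ⟨h, p', h1, q1, ?_, by simp; omega⟩
      rw [wordProd_append, h3, wordProd_append, wordProd_append, wordProd_singleton, mul_assoc, q2]
    · refine ⟨h ++ [r'], p, ?_, h2, ?_, by simp; omega⟩
      · intro z hz
        simp at hz
        rcases hz with hz | rfl
        · exact h1 hz
        · exact q1
      · rw [wordProd_append, h3]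
        simp only [wordProd_append, wordProd_singleton, mul_assoc, q2]

/-- Local path structure around an edge. -/
def SideC (M : CoxeterMatrix (Fin n)) : Prop := ∀ s t : Fin n, 3 ≤ M s t →
  ∃ (β : Prop) (c : List (Fin n)), Ch M β c ∧ (∀ x ∈ c, M s x = 2) ∧
    (∀ a c', c = a :: c' → 3 ≤ M t a ∧ ∀ x ∈ c', M t x = 2) ∧
    (∀ r, M s r = 2 → r ∉ c → M t r = 2 ∧ ∀ x ∈ c, M r x = 2)

theorem split (P : Fin n → Prop) [DecidablePred P] : ∀ l : List (Fin n),
    (∀ r ∈ l, ¬ P r → ∀ x ∈ l, P x → M r x = 2) →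
    cs.wordProd l = cs.wordProd (l.filter (fun x => ¬ P x) ++ l.filter (fun x => P x)) := by
  intro l
  induction l using List.reverseRecOn with
  | nil => intro _; simp
  | append_singleton l r ih =>
    intro h
    have ih' := ih (fun r hr hp x hx => h r (by simp [hr]) hp x (by simp [hx]))
    rw [wordProd_append, ih']
    by_cases hP : P r
    · simp [hP, wordProd_append, mul_assoc]
    · have := word_comm cs (s := r) (l := l.filter (fun x => P x)) (by
        intro x hx
        simp at hx
        exact h r (by simp) hP x (by simp [hx.1]) hx.2)
      simp only [List.filter_append, wordProd_append, wordProd_singleton, mul_assoc]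
      rw [← this]
      simp [hP, mul_assoc]

theorem sideP_of (hS : SideC M) : SideP cs := by
  intro s t x2 hm hx
  obtain ⟨β, c, hc, hsc, hhd, hout⟩ := hS s t hm
  have e := split cs (fun x => x ∈ c) x2 (by
    intro r hr hrc x _ hxc
    exact (hout r (hx r hr) hrc).2 x hxc)
  obtain ⟨h, p, h1, h2, h3, h5⟩ := nform cs hc (x2.filter (fun x => x ∈ c)) (by
    intro z hz; simp at hz; exact hz.2)
  have hct : ∀ x ∈ c.tail, M t x = 2 := by
    rcases c with _ | ⟨a, c⟩
    · simp
    · exact (hhd a c rfl).2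
  refine ⟨x2.filter (fun x => ¬ x ∈ c) ++ h, p, ?_, ?_, ?_, ?_, ?_⟩
  · rw [e, wordProd_append, h3]
    simp only [wordProd_append, mul_assoc]
  · have := List.length_eq_length_filter_add (l := x2) (fun x => decide (x ∈ c))
    simp at this h5 ⊢
    omega
  · intro r hr
    rcases List.mem_append.1 hr with hr | hr
    · simp at hr
      exact ⟨hx r hr.1, (hout r (hx r hr.1) hr.2).1⟩
    · exact ⟨hsc r (List.mem_of_mem_tail (h1 hr)), hct r (h1 hr)⟩
  · intro r hr
    exact hsc r (pth_sub h2 hr)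
  · have hch := pth_chain h2 hc
    rcases p with _ | ⟨a, p⟩
    · simp
    · obtain ⟨c', rfl⟩ := pth_head h2
      rw [List.isChain_cons_cons]
      exact ⟨(hhd a c' rfl).1, hch⟩

theorem fw_nil : FW cs [] := by
  refine ⟨by simp [CoxeterSystem.IsReduced], ?_⟩
  rintro ⟨a, b, i, j, hm, -, hl⟩
  simp at hl
  omega

theorem main_chain (h4 : SmallM M) (hS : SideP cs) {β : Prop} : ∀ c : List (Fin n), Ch M β c →
    ∀ x : List (Fin n), x ⊆ c → ∃ ω : List (Fin n), ω ⊆ c ∧ cs.wordProd ω = cs.wordProd x ∧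
      ω.length ≤ x.length ∧ ∀ κ : List (Fin n), κ.Sublist ω →
        ∃ (a m : ℕ) (ω' : List (Fin n)), m + κ.length ≤ ω.length ∧ FW cs ω' ∧ ω' ⊆ c ∧
          bprod M κ = a • (qc ^ m • bprod M ω') := by
  intro c
  induction c with
  | nil =>
    intro _ x hx
    have := List.subset_nil.1 hx
    subst this
    refine ⟨[], by simp, rfl, le_rfl, ?_⟩
    intro κ hκ
    rw [List.sublist_nil] at hκ
    subst hκ
    exact ⟨1, 0, [], by simp, fw_nil cs, by simp, by simp⟩
  | cons a c ih =>
    intro hc x hx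
    obtain ⟨h, p, h1, h2, h3, h5⟩ := nform cs hc x hx
    obtain ⟨ω1, o1, o2, o3, o4⟩ := ih (ch_tail hc) h h1
    have hpc := pth_sub h2
    refine ⟨ω1 ++ p, ?_, ?_, ?_, ?_⟩
    · intro z hz
      rcases List.mem_append.1 hz with hz | hz
      · exact List.mem_cons_of_mem _ (o1 hz)
      · exact hpc hz
    · rw [h3, wordProd_append, o2, wordProd_append]
    · simp; omega
    · intro κ hκ
      obtain ⟨κ1, κ2, rfl, k1, k2⟩ := List.sublist_append_iff.1 hκ
      obtain ⟨a1, m1, ω', q1, q2, q3, q4⟩ := o4 κ1 k1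
      have hch := pth_chain h2 hc
      have hk2 : κ2 ⊆ a :: c := fun z hz => hpc (k2.subset hz)
      rcases p with _ | ⟨b, p⟩
      · rw [List.sublist_nil] at k2
        subst k2
        refine ⟨a1, m1, ω', by simpa using q1, q2, fun z hz => List.mem_cons_of_mem _ (q3 hz), ?_⟩
        simpa using q4
      · obtain ⟨c', hc'⟩ := pth_head h2
        simp only [List.cons.injEq] at hc'
        obtain ⟨rfl, rfl⟩ := hc'
        rcases List.sublist_cons_iff.1 k2 with k3 | ⟨κ', rfl, k3⟩
        · obtain ⟨a2, m2, ω2, f2, s2, b2, l2⟩ := (run cs h4 hS p).1 κ2 ω' q2 hch.tail k3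
          refine ⟨a1 * a2, m1 + m2, ω2, by simp; omega, f2, ?_, ?_⟩
          · intro z hz
            rcases List.mem_append.1 (s2 hz) with hz | hz
            · exact List.mem_cons_of_mem _ (q3 hz)
            · exact hk2 hz
          · rw [bprod_append, q4, comb_mul, b2, comb]
        · have hF := l3 cs h4 (s := a) q2 (fun hm => ch_not_mem hc (q3 hm))
          obtain ⟨a2, m2, ω2, f2, s2, b2, l2⟩ := (run cs h4 hS p).2 κ' (ω' ++ [a]) a hF
            (desc_last cs hF.1) hch k3
          refine ⟨a1 * a2, m1 + m2, ω2, by simp; omega, f2, ?_, ?_⟩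
          · intro z hz
            rcases List.mem_append.1 (s2 hz) with hz | hz
            · rcases List.mem_append.1 hz with hz | hz
              · exact List.mem_cons_of_mem _ (q3 hz)
              · simp at hz
                simp [hz]
            · exact hk2 (List.mem_cons_of_mem _ hz)
          · rw [bprod_append] at b2
            rw [bprod_append, q4, comb_mul, bprod_cons, ← mul_assoc, ← comb, ← b2]
            simp [bprod]

/-- The list `n - d, …, n - 1`. -/
def upN (n : ℕ) : (d : ℕ) → d ≤ n → List (Fin n)
  | 0, _ => []
  | d + 1, h => ⟨n - (d + 1), by omega⟩ :: upN n d (by omega)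

/-- The list `d - 1, …, 0`. -/
def downN (n : ℕ) : (d : ℕ) → d ≤ n → List (Fin n)
  | 0, _ => []
  | d + 1, h => ⟨d, by omega⟩ :: downN n d (by omega)

theorem mem_upN : ∀ (d : ℕ) (h : d ≤ n) (x : Fin n), x ∈ upN n d h ↔ n - d ≤ x.1
  | 0, h, x => by simp [upN]
  | d + 1, h, x => by
    have := x.2
    simp only [upN, List.mem_cons, mem_upN d, Fin.ext_iff]
    omega

theorem mem_downN : ∀ (d : ℕ) (h : d ≤ n) (x : Fin n), x ∈ downN n d h ↔ x.1 < d
  | 0, h, x => by simp [downN]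
  | d + 1, h, x => by
    simp only [downN, List.mem_cons, mem_downN d, Fin.ext_iff]
    omega

/-- Explicit description of the matrices of type `A` (`β` false) and `B` (`β` true). -/
def IsAB (M : CoxeterMatrix (Fin n)) (β : Prop) : Prop :=
  ∀ i j : Fin n, (i.1 = j.1 → M i j = 1) ∧
    ((i.1 + 1 = j.1 ∨ j.1 + 1 = i.1) →
      (β → (i.1 + 1 = n ∨ j.1 + 1 = n) → M i j = 4) ∧
      (¬ (β ∧ (i.1 + 1 = n ∨ j.1 + 1 = n)) → M i j = 3)) ∧
    ((i.1 + 1 < j.1 ∨ j.1 + 1 < i.1) → M i j = 2)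

theorem isAB_A : IsAB (CoxeterMatrix.A n) False := by
  intro i j
  simp only [CoxeterMatrix.A, Matrix.of_apply, Fin.ext_iff]
  refine ⟨fun h => ?_, fun h => ⟨fun h => h.elim, fun _ => ?_⟩, fun h => ?_⟩
  · rw [if_pos h]
  · rw [if_neg (by omega), if_pos (by omega)]
  · rw [if_neg (by omega), if_neg (by omega)]

theorem isAB_B : IsAB (CoxeterMatrix.B n) True := by
  intro i j
  have hi := i.2
  have hj := j.2
  simp only [CoxeterMatrix.B, Matrix.of_apply, Fin.ext_iff]
  refine ⟨fun h => ?_, fun h => ⟨fun _ h' => ?_, fun h' => ?_⟩, fun h => ?_⟩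
  · rw [if_pos h]
  · rw [if_neg (by omega), if_pos (by omega)]
  · simp only [true_and] at h'
    rw [if_neg (by omega), if_neg (by omega), if_pos (by omega)]
  · rw [if_neg (by omega), if_neg (by omega), if_neg (by omega)]

theorem isAB_cases {β : Prop} (h : IsAB M β) (i j : Fin n) :
    (i.1 = j.1 ∧ M i j = 1) ∨ ((i.1 + 1 = j.1 ∨ j.1 + 1 = i.1) ∧ (M i j = 3 ∨ M i j = 4)) ∨
    ((i.1 + 1 < j.1 ∨ j.1 + 1 < i.1) ∧ M i j = 2) := by
  obtain ⟨h1, h2, h3⟩ := h i j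
  rcases lt_trichotomy i.1 j.1 with hl | hl | hl
  · rcases Nat.lt_or_ge (i.1 + 1) j.1 with h' | h'
    · exact Or.inr (Or.inr ⟨Or.inl h', h3 (Or.inl h')⟩)
    · have hh : i.1 + 1 = j.1 ∨ j.1 + 1 = i.1 := by omega
      refine Or.inr (Or.inl ⟨hh, ?_⟩)
      by_cases hb : β ∧ (i.1 + 1 = n ∨ j.1 + 1 = n)
      · exact Or.inr ((h2 hh).1 hb.1 hb.2)
      · exact Or.inl ((h2 hh).2 hb)
  · exact Or.inl ⟨hl, h1 hl⟩
  · rcases Nat.lt_or_ge (j.1 + 1) i.1 with h' | h'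
    · exact Or.inr (Or.inr ⟨Or.inr h', h3 (Or.inr h')⟩)
    · have hh : i.1 + 1 = j.1 ∨ j.1 + 1 = i.1 := by omega
      refine Or.inr (Or.inl ⟨hh, ?_⟩)
      by_cases hb : β ∧ (i.1 + 1 = n ∨ j.1 + 1 = n)
      · exact Or.inr ((h2 hh).1 hb.1 hb.2)
      · exact Or.inl ((h2 hh).2 hb)

theorem isAB_small {β : Prop} (h : IsAB M β) : SmallM M := by
  intro i j
  have := isAB_cases h i j
  omega

theorem ch_up {β : Prop} (h : IsAB M β) : ∀ (d : ℕ) (hd : d ≤ n), Ch M β (upN n d hd)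
  | 0, _ => trivial
  | 1, _ => trivial
  | d + 2, hd => by
    have ih := ch_up h (d + 1) (by omega)
    refine ⟨?_, ?_, ih⟩
    · obtain ⟨-, h2, -⟩ := h ⟨n - (d + 2), by omega⟩ ⟨n - (d + 1), by omega⟩
      have h2' := h2 (by simp; omega)
      by_cases hb : β ∧ d = 0
      · left
        obtain ⟨hβ, rfl⟩ := hb
        exact ⟨hβ, rfl, h2'.1 hβ (by simp; omega)⟩
      · right
        refine ⟨?_, h2'.2 ?_⟩
        · rintro ⟨hβ, he⟩
          rcases d with _ | d
          · exact hb ⟨hβ, rfl⟩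
          · simp [upN] at he
        · rintro ⟨hβ, he⟩
          apply hb
          simp at he
          exact ⟨hβ, by omega⟩
    · intro x hx
      rw [mem_upN] at hx
      exact (h _ x).2.2 (by simp; omega)

theorem ch_down {β : Prop} (h : IsAB M β) : ∀ (d : ℕ) (hd : d < n), Ch M False (downN n d hd.le)
  | 0, _ => trivial
  | 1, _ => trivial
  | d + 2, hd => by
    have ih := ch_down h (d + 1) (by omega)
    refine ⟨?_, ?_, ih⟩
    · obtain ⟨-, h2, -⟩ := h ⟨d + 1, by omega⟩ ⟨d, by omega⟩
      have h2' := h2 (by simp)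
      right
      refine ⟨by simp, h2'.2 ?_⟩
      rintro ⟨-, he⟩
      simp at he
      omega
    · intro x hx
      rw [mem_downN] at hx
      exact (h _ x).2.2 (by simp; omega)

theorem isAB_side {β : Prop} (h : IsAB M β) : SideC M := by
  intro s t hm
  have key := isAB_cases h
  have hst : s.1 + 1 = t.1 ∨ t.1 + 1 = s.1 := by have := key s t; omega
  have hs2 := s.2
  have ht2 := t.2
  rcases hst with hst | hst
  · refine ⟨β, upN n (n - (t.1 + 1)) (by omega), ch_up h _ _, ?_, ?_, ?_⟩
    · intro x hx
      rw [mem_upN] at hx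
      have := key s x
      omega
    · intro a c' hc
      obtain ⟨d, hd⟩ : ∃ d, n - (t.1 + 1) = d + 1 := by
        rcases hn : n - (t.1 + 1) with _ | d
        · simp [hn, upN] at hc
        · exact ⟨d, rfl⟩
      simp only [hd, upN, List.cons.injEq] at hc
      obtain ⟨rfl, rfl⟩ := hc
      constructor
      · have := key t ⟨n - (d + 1), by omega⟩
        simp only at this
        omega
      · intro x hx
        rw [mem_upN] at hx
        have := key t x
        omega
    · intro r hr hrc
      rw [mem_upN] at hrc
      have h1 := key s r
      have h2 := key t r
      refine ⟨by omega, ?_⟩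
      intro x hx
      rw [mem_upN] at hx
      have := key r x
      omega
  · refine ⟨False, downN n t.1 (by omega), ch_down h _ ht2, ?_, ?_, ?_⟩
    · intro x hx
      rw [mem_downN] at hx
      have := key s x
      omega
    · intro a c' hc
      obtain ⟨d, hd⟩ : ∃ d, t.1 = d + 1 := by
        rcases hn : t.1 with _ | d
        · simp [hn, downN] at hc
        · exact ⟨d, rfl⟩
      simp only [hd, downN, List.cons.injEq] at hc
      obtain ⟨rfl, rfl⟩ := hc
      constructor
      · have := key t ⟨d, by omega⟩
        simp only at this
        omega
      · intro x hx
        rw [mem_downN] at hx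
        have := key t x
        omega
    · intro r hr hrc
      rw [mem_downN] at hrc
      have h1 := key s r
      have h2 := key t r
      refine ⟨by omega, ?_⟩
      intro x hx
      rw [mem_downN] at hx
      have := key r x
      omega

theorem final {β : Prop} (h : IsAB M β) (w : W) :
    ∃ ω : List (Fin n), cs.IsReduced ω ∧ cs.wordProd ω = w ∧
      ∀ κ : List (Fin n), κ.Sublist ω →
        ∃ (x : W) (a m : ℕ), cs.FC x ∧ m ≤ ω.length - κ.length ∧
          ∀ ωx : List (Fin n), cs.IsReduced ωx → cs.wordProd ωx = x →
            bprod M κ = a • (qc ^ m • bprod M ωx) := by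
  have h4 := isAB_small h
  obtain ⟨x, hx, rfl⟩ := cs.exists_isReduced w
  obtain ⟨ω, -, o2, o3, o4⟩ := main_chain cs h4 (sideP_of cs (isAB_side h)) _ (ch_up h n le_rfl) x
    (by intro z _; rw [mem_upN]; omega)
  refine ⟨ω, ?_, o2, ?_⟩
  · unfold CoxeterSystem.IsReduced
    have := cs.length_wordProd_le ω
    have h1 := hx.eq
    rw [← o2] at h1
    omega
  · intro κ hκ
    obtain ⟨a, m, ω', q1, q2, -, q4⟩ := o4 κ hκ
    refine ⟨cs.wordProd ω', a, m, q2.2, by omega, ?_⟩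
    intro ωx r1 r2
    rw [q4, (indep cs h4 q2 r1 r2.symm).2]

end Chains

/-- Every `w` in a Coxeter group of type `A` or `B` has a reduced expression `s_1 ⋯ s_n` with
the deletion property: for any subword (subsequence) `s_{i_1} ⋯ s_{i_k}`, the product
`b_{s_{i_1}} ⋯ b_{s_{i_k}}` in `TL(X)` equals `a q_c^m b_x` for some fully commutative `x`
and nonnegative integers `a`, `m` with `m ≤ n - k`. -/
theorem exists_reduced_word_with_deletion_property {n : ℕ} {M : CoxeterMatrix (Fin n)}
    (hM : M = CoxeterMatrix.Aₙ n ∨ M = CoxeterMatrix.Bₙ n)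
    (cs : CoxeterSystem M W) (w : W) :
    ∃ ω : List (Fin n), cs.IsReduced ω ∧ cs.wordProd ω = w ∧
      ∀ κ : List (Fin n), κ.Sublist ω →
        ∃ (x : W) (a m : ℕ), cs.FC x ∧ m ≤ ω.length - κ.length ∧
          ∀ ωx : List (Fin n), cs.IsReduced ωx → cs.wordProd ωx = x →
            bprod M κ = a • (qc ^ m • bprod M ωx) := by
  rcases hM with rfl | rfl
  · exact final cs isAB_A w
  · exact final cs isAB_B w
end
end

section
/- Let w = s_1···s_n be a reduced expression in a Coxeter group of type A or B and let 1 ≤ i_1 < ··· < i_k ≤ n. Then in TL(X) the product b_{s_{i_1}}···b_{s_{i_k}} equals a q_c^m b_x where a, m are nonnegative integers and x ∈ W_c satisfies ℓ(x) ≤ k and x ≤ w in Bruhat–Chevalley order. -/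
open CoxeterSystem LaurentPolynomial

noncomputable section

variable {B : Type*} {W : Type*} [Group W]

namespace BS
variable {M : CoxeterMatrix B} (cs : CoxeterSystem M W)

lemma end_mul_apply {α : Type*} (f g : Function.End α) (x : α) : (f * g) x = f (g x) := rfl

lemma end_one_apply {α : Type*} (x : α) : (1 : Function.End α) x = x := rfl

/-- One commutation move. -/
inductive CStep (M : CoxeterMatrix B) : List B → List B → Prop
  | mk (u v : List B) (i j : B) : M i j = 2 → CStep M (u ++ i :: j :: v) (u ++ j :: i :: v)

/-- One braid move. -/
inductive BStep (M : CoxeterMatrix B) : List B → List B → Prop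
  | m2 (u v : List B) (i j : B) : M i j = 2 → BStep M (u ++ i :: j :: v) (u ++ j :: i :: v)
  | m3 (u v : List B) (i j : B) : M i j = 3 →
      BStep M (u ++ i :: j :: i :: v) (u ++ j :: i :: j :: v)
  | m4 (u v : List B) (i j : B) : M i j = 4 →
      BStep M (u ++ i :: j :: i :: j :: v) (u ++ j :: i :: j :: i :: v)

abbrev CEq (M : CoxeterMatrix B) := Relation.ReflTransGen (CStep M)
abbrev BEq (M : CoxeterMatrix B) := Relation.ReflTransGen (BStep M)

lemma CStep.symm {a b : List B} (h : CStep M a b) : CStep M b a := by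
  cases h with
  | mk u v i j h => exact .mk u v j i (by rw [M.symmetric]; exact h)

lemma BStep.symm {a b : List B} (h : BStep M a b) : BStep M b a := by
  cases h with
  | m2 u v i j h => exact .m2 u v j i (by rw [M.symmetric]; exact h)
  | m3 u v i j h => exact .m3 u v j i (by rw [M.symmetric]; exact h)
  | m4 u v i j h => exact .m4 u v j i (by rw [M.symmetric]; exact h)

lemma CEq.symm {a b : List B} (h : CEq M a b) : CEq M b a :=
  by
  have : Std.Symm (CStep M) := ⟨fun _ _ h => CStep.symm h⟩
  exact Std.Symm.symm _ _ h

lemma BEq.symm {a b : List B} (h : BEq M a b) : BEq M b a :=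
  by
  have : Std.Symm (BStep M) := ⟨fun _ _ h => BStep.symm h⟩
  exact Std.Symm.symm _ _ h

lemma CEq.cons {a b : List B} (k : B) (h : CEq M a b) : CEq M (k :: a) (k :: b) := by
  refine Relation.ReflTransGen.lift (k :: ·) ?_ _ _ h
  rintro _ _ ⟨u, v, i, j, h⟩
  exact .mk (k :: u) v i j h

lemma BEq.cons {a b : List B} (k : B) (h : BEq M a b) : BEq M (k :: a) (k :: b) := by
  refine Relation.ReflTransGen.lift (k :: ·) ?_ _ _ h
  intro a b h
  cases h with
  | m2 u v i j h => exact .m2 (k :: u) v i j h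
  | m3 u v i j h => exact .m3 (k :: u) v i j h
  | m4 u v i j h => exact .m4 (k :: u) v i j h

/-- Sublists can be transported along commutation moves. -/
lemma CEq.sublist {a b : List B} (h : CEq M a b) :
    ∀ c : List B, c.Sublist b → ∃ d : List B, d.Sublist a ∧ CEq M d c := by
  induction h with
  | refl => intro c hc; exact ⟨c, hc, .refl⟩
  | tail _ hs ih =>
    intro c hc
    obtain ⟨u, v, i, j, h⟩ := hs
    suffices ∃ d : List B, d.Sublist (u ++ i :: j :: v) ∧ CEq M d c by
      obtain ⟨d, hd, hdc⟩ := this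
      obtain ⟨e, he, hed⟩ := ih d hd
      exact ⟨e, he, hed.trans hdc⟩
    obtain ⟨c1, c2, rfl, h1, h2⟩ := List.sublist_append_iff.1 hc
    rcases List.sublist_cons_iff.1 h2 with h3 | ⟨r, rfl, h3⟩
    · exact ⟨c1 ++ c2, h1.append (h3.trans (List.Sublist.cons_cons _ (List.sublist_cons_self _ _))), .refl⟩
    · rcases List.sublist_cons_iff.1 h3 with h4 | ⟨r, rfl, h4⟩
      · exact ⟨c1 ++ j :: r, h1.append ((h4.cons_cons j).cons i), .refl⟩
      · exact ⟨c1 ++ i :: j :: r, h1.append ((h4.cons_cons j).cons_cons i),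
          Relation.ReflTransGen.single (.mk _ _ _ _ h)⟩

/-! ### products in TL -/

lemma bgen_sq (i : B) : bgen M i * bgen M i = qc • bgen M i := by
  have := RingQuot.mkAlgHom_rel LA (TLRel.sq (M := M) i)
  simpa [bgen] using this

lemma bgen_comm {i j : B} (h : M i j = 2) : bgen M i * bgen M j = bgen M j * bgen M i := by
  have := RingQuot.mkAlgHom_rel LA (TLRel.comm (M := M) i j h)
  simpa [bgen] using this

lemma bgen_three {i j : B} (h : M i j = 3) : bgen M i * bgen M j * bgen M i = bgen M i := by
  have := RingQuot.mkAlgHom_rel LA (TLRel.braid3 (M := M) i j h)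
  simpa [bgen] using this

lemma bgen_four {i j : B} (h : M i j = 4) :
    bgen M i * bgen M j * bgen M i * bgen M j = 2 * (bgen M i * bgen M j) := by
  have := RingQuot.mkAlgHom_rel LA (TLRel.braid4 (M := M) i j h)
  simpa [bgen, map_ofNat] using this

lemma bprod_append (u v : List B) : bprod M (u ++ v) = bprod M u * bprod M v := by
  simp [bprod]

lemma bprod_cons (i : B) (v : List B) : bprod M (i :: v) = bgen M i * bprod M v := by
  simp [bprod]

lemma CEq.bprod_eq {a b : List B} (h : CEq M a b) : bprod M a = bprod M b := by
  induction h with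
  | refl => rfl
  | tail _ hs ih =>
    rw [ih]
    obtain ⟨u, v, i, j, h⟩ := hs
    simp only [bprod_append, bprod_cons, ← mul_assoc (bgen M i), ← mul_assoc (bgen M j), bgen_comm h]

/-- A word with a reducible factor. -/
inductive Bad (M : CoxeterMatrix B) : List B → Prop
  | sq (u v : List B) (i : B) : Bad M (u ++ i :: i :: v)
  | m3 (u v : List B) (i j : B) : M i j = 3 → Bad M (u ++ i :: j :: i :: v)
  | m4 (u v : List B) (i j : B) : M i j = 4 → Bad M (u ++ i :: j :: i :: j :: v)

lemma Bad.reduce {a : List B} (h : Bad M a) : ∃ (b : List B) (c m : ℕ), b.Sublist a ∧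
    b.length < a.length ∧ bprod M a = c • (qc ^ m • bprod M b) := by
  cases h with
  | sq u v i =>
    refine ⟨u ++ i :: v, 1, 1, ?_, by simp, ?_⟩
    · exact (List.Sublist.refl u).append (List.sublist_cons_self _ _)
    · simp only [bprod_append, bprod_cons, ← mul_assoc (bgen M i), bgen_sq]
      simp
  | m3 u v i j h =>
    refine ⟨u ++ i :: v, 1, 0, ?_, by simp, ?_⟩
    · exact (List.Sublist.refl u).append ((List.sublist_cons_self _ _).cons _)
    · simp only [bprod_append, bprod_cons, ← mul_assoc (bgen M i), ← mul_assoc (bgen M j)]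
      simp only [bgen_three h]
      simp
  | m4 u v i j h =>
    refine ⟨u ++ i :: j :: v, 2, 0, ?_, by simp, ?_⟩
    · exact (List.Sublist.refl u).append (((List.Sublist.refl _).cons _).cons _)
    · have : bgen M i * (bgen M j * (bgen M i * (bgen M j * bprod M v)))
          = 2 * (bgen M i * bgen M j) * bprod M v := by
        rw [← bgen_four h]; simp only [mul_assoc]
      simp only [bprod_append, bprod_cons, this]
      simp only [pow_zero, one_smul, two_mul, two_smul, mul_add, add_mul, mul_assoc]

/-- Good words. -/
def Good (M : CoxeterMatrix B) (a : List B) : Prop := ∀ b, CEq M a b → ¬ Bad M b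

theorem exists_good (k : List B) : ∃ (b : List B) (c m : ℕ), b.Sublist k ∧ Good M b ∧
    bprod M k = c • (qc ^ m • bprod M b) := by
  induction hn : k.length using Nat.strong_induction_on generalizing k with
  | _ n ih =>
    by_cases hg : Good M k
    · exact ⟨k, 1, 0, List.Sublist.refl _, hg, by simp⟩
    · unfold Good at hg
      push Not at hg
      obtain ⟨b, hkb, hb⟩ := hg
      obtain ⟨b', c, m, hb', hlt, he⟩ := hb.reduce
      obtain ⟨d, hd, hdb⟩ := hkb.sublist b' hb'
      have hl : ∀ {a b : List B}, CEq M a b → a.length = b.length := by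
        intro a b h
        induction h with
        | refl => rfl
        | tail _ hs ih => rw [ih]; cases hs; simp
      obtain ⟨f, c', m', hf, hgf, hef⟩ := ih d.length (by rw [hl hdb, ← hn, hl hkb]; exact hlt) d rfl
      refine ⟨f, c * c', m + m', hf.trans hd, hgf, ?_⟩
      rw [hkb.bprod_eq, he, ← hdb.bprod_eq, hef, smul_comm (qc ^ m) c', smul_smul, smul_smul, pow_add]
end BS

namespace BS
variable {M : CoxeterMatrix B} (cs : CoxeterSystem M W)

open Classical in
/-- The action on reflections with sign. -/
def act (i : B) : Function.End (W × ZMod 2) := fun p =>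
  (cs.simple i * p.1 * cs.simple i, p.2 + if p.1 = cs.simple i then 1 else 0)

open Classical in
lemma act_word (ω : List B) (t : W) (e : ZMod 2) :
    (ω.map (act cs)).prod (t, e) =
      (cs.wordProd ω * t * (cs.wordProd ω)⁻¹, e + ((cs.rightInvSeq ω).count t : ℕ)) := by
  induction ω with
  | nil => simp [end_one_apply]
  | cons i ω ih =>
    rw [List.map_cons, List.prod_cons, end_mul_apply, ih]
    simp only [act, cs.wordProd_cons, rightInvSeq, List.count_cons, mul_inv_rev, cs.inv_simple]
    have h : (cs.wordProd ω * t * (cs.wordProd ω)⁻¹ = cs.simple i) ↔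
        ((cs.wordProd ω)⁻¹ * cs.simple i * cs.wordProd ω = t) := by
      constructor
      · intro h; rw [← h]; group
      · intro h; rw [← h]; group
    simp only [h, beq_iff_eq]
    simp only [mul_assoc, Prod.mk.injEq, true_and]
    push_cast
    ring

lemma alt_even (f : B → Function.End (W × ZMod 2)) (i j : B) (m : ℕ) :
    ((alternatingWord i j (2 * m)).map f).prod = (f i * f j) ^ m := by
  induction m with
  | zero => simp [alternatingWord]
  | succ m ih =>
    rw [show 2 * (m + 1) = 2 * m + 1 + 1 by ring, alternatingWord_succ, alternatingWord_succ]
    simp [ih, pow_succ]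

lemma alt_prod (i j : B) (m : ℕ) :
    cs.wordProd (alternatingWord i j (2 * m)) = (cs.simple i * cs.simple j) ^ m := by
  rw [cs.prod_alternatingWord_eq_mul_pow]; simp

open Classical in
lemma count_lis_even (i j : B) (t : W) :
    (((cs.leftInvSeq (alternatingWord i j (2 * M i j))).count t : ℕ) : ZMod 2) = 0 := by
  set l := cs.leftInvSeq (alternatingWord i j (2 * M i j)) with hl
  have hlen : l.length = 2 * M i j := by simp [hl]
  have hh : l.drop (M i j) = l.take (M i j) := by
    apply List.ext_getElem
    · simp [hlen]; omega
    · intro k h1 h2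
      have hk : k < M i j := by simp at h2; exact h2.1
      rw [List.getElem_drop, List.getElem_take]
      simp only [hl]
      rw [cs.getElem_leftInvSeq_alternatingWord i j _ _ (by omega),
        cs.getElem_leftInvSeq_alternatingWord i j _ _ (by omega),
        cs.prod_alternatingWord_eq_mul_pow, cs.prod_alternatingWord_eq_mul_pow]
      have e1 : (2 * (M i j + k) + 1) / 2 = M i j + k := by omega
      have e2 : (2 * k + 1) / 2 = k := by omega
      rw [e1, e2, pow_add, cs.simple_mul_simple_pow' i j]
      simp
  rw [← List.take_append_drop (M i j) l, List.count_append, hh]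
  push_cast
  exact CharTwo.add_self_eq_zero _

lemma alt_reverse (i j : B) (m : ℕ) :
    (alternatingWord i j (2 * m)).reverse = alternatingWord j i (2 * m) := by
  induction m with
  | zero => simp [alternatingWord]
  | succ m ih =>
    rw [show 2 * (m + 1) = 2 * m + 1 + 1 by ring, alternatingWord_succ, alternatingWord_succ,
      alternatingWord_succ' j i, alternatingWord_succ' j i]
    simp [ih]

lemma act_liftable : M.IsLiftable (act cs) := by
  classical
  intro i j
  funext ⟨t, e⟩
  rw [← alt_even, act_word, alt_prod, cs.simple_mul_simple_pow]
  have h := count_lis_even cs j i t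
  rw [M.symmetric j i] at h
  have h2 : cs.rightInvSeq (alternatingWord i j (2 * M i j)) =
      (cs.leftInvSeq (alternatingWord j i (2 * M i j))).reverse := by
    rw [← cs.rightInvSeq_reverse, alt_reverse]
  rw [h2, List.count_reverse, h]
  simp [end_one_apply]

open Classical in
lemma count_eq {ω ω' : List B} (h : cs.wordProd ω = cs.wordProd ω') (t : W) :
    (((cs.rightInvSeq ω).count t : ℕ) : ZMod 2) = ((cs.rightInvSeq ω').count t : ℕ) := by
  have key : ∀ ω : List B, cs.lift ⟨act cs, act_liftable cs⟩ (cs.wordProd ω) =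
      (ω.map (act cs)).prod := by
    intro ω
    rw [wordProd, map_list_prod, List.map_map]
    congr 2
    funext i
    simp
  have h1 := key ω
  rw [h, key ω'] at h1
  have h2 := congrFun h1 (t, 0)
  rw [act_word, act_word] at h2
  simpa using (congrArg Prod.snd h2).symm

lemma right_exchange {ω : List B} {i : B}
    (hi : cs.IsRightDescent (cs.wordProd ω) i) : cs.simple i ∈ cs.rightInvSeq ω := by
  classical
  obtain ⟨ω', hr, he⟩ := cs.exists_isReduced (cs.wordProd ω * cs.simple i)
  have hp : cs.wordProd (ω'.concat i) = cs.wordProd ω := by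
    rw [cs.wordProd_concat, ← he]; simp
  have hred : cs.IsReduced (ω'.concat i) := by
    unfold CoxeterSystem.IsReduced
    rw [hp, List.length_concat, ← hr.eq, ← he]
    exact (cs.isRightDescent_iff.1 hi).symm
  have hc := count_eq cs hp (cs.simple i)
  have hm : cs.simple i ∈ cs.rightInvSeq (ω'.concat i) := by
    rw [cs.rightInvSeq_concat]; simp
  rw [List.count_eq_one_of_mem (IsReduced.nodup_rightInvSeq cs hred) hm] at hc
  by_contra hn
  rw [List.count_eq_zero_of_not_mem hn] at hc
  simp at hc

lemma left_exchange {ω : List B} {i : B}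
    (hi : cs.IsLeftDescent (cs.wordProd ω) i) :
    ∃ k < ω.length, cs.wordProd (i :: ω.eraseIdx k) = cs.wordProd ω := by
  have h := right_exchange cs (ω := ω.reverse) (i := i)
    (by rw [cs.wordProd_reverse]; exact cs.isRightDescent_inv_iff.2 hi)
  rw [cs.rightInvSeq_reverse, List.mem_reverse] at h
  obtain ⟨k, hk, he⟩ := List.mem_iff_getElem.1 h
  refine ⟨k, by simpa using hk, ?_⟩
  have := cs.getD_leftInvSeq_mul_wordProd ω k
  rw [List.getD_eq_getElem _ _ hk, he] at this
  rw [cs.wordProd_cons, ← this]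
  simp

end BS

namespace BS
variable {n : ℕ} {M : CoxeterMatrix (Fin n)} (cs : CoxeterSystem M W)

/-- A Cartan matrix for a Coxeter matrix with entries at most four. -/
def cartan (M : CoxeterMatrix (Fin n)) (i j : Fin n) : ℤ :=
  if M i j = 1 then 2 else if M i j = 2 then 0 else if M i j = 3 then -1
    else if i < j then -1 else -2

/-- The linear form of a simple coroot. -/
def lform (M : CoxeterMatrix (Fin n)) (i : Fin n) : (Fin n → ℤ) →ₗ[ℤ] ℤ :=
  ∑ j, cartan M i j • LinearMap.proj j

lemma lform_single (i j : Fin n) (c : ℤ) : lform M i (Pi.single j c) = cartan M i j * c := by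
  simp [lform, Pi.single_apply]

/-- Simple reflection in the geometric representation. -/
def refl (M : CoxeterMatrix (Fin n)) (i : Fin n) : Function.End (Fin n → ℤ) := fun x =>
  x + Pi.single i (- lform M i x)

lemma cartan_self (i : Fin n) : cartan M i i = 2 := by simp [cartan]

lemma refl_apply (i j : Fin n) (x : Fin n → ℤ) (a b : ℤ) :
    refl M i (x + Pi.single i a + Pi.single j b) =
      x + Pi.single i (- a - lform M i x - cartan M i j * b) + Pi.single j b := by
  simp only [refl, map_add, lform_single, cartan_self]
  rw [show - a - lform M i x - cartan M i j * b =
    a + -(lform M i x + 2 * a + cartan M i j * b) by ring, Pi.single_add]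
  abel

lemma refl_apply' (i j : Fin n) (x : Fin n → ℤ) (a b : ℤ) :
    refl M j (x + Pi.single i a + Pi.single j b) =
      x + Pi.single i a + Pi.single j (- b - lform M j x - cartan M j i * a) := by
  rw [add_right_comm, refl_apply, add_right_comm]

lemma refl_liftable (H : ∀ i j, i ≠ j → M i j = 2 ∨ M i j = 3 ∨ M i j = 4) :
    M.IsLiftable (refl M) := by
  intro i j
  by_cases hij : i = j
  · subst hij
    rw [M.diagonal, pow_one]
    funext x
    simp only [end_mul_apply, end_one_apply]
    simp only [refl, map_add, lform_single, cartan_self, add_assoc, ← Pi.single_add]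
    rw [show -(lform M i) x + -((lform M i) x + 2 * -(lform M i) x) = 0 by ring]
    simp
  funext x
  have hx : x = x + Pi.single i 0 + Pi.single j 0 := by simp
  have hs := M.symmetric i j
  have h4 : M i j = 4 → (cartan M i j = -1 ∧ cartan M j i = -2) ∨
      (cartan M i j = -2 ∧ cartan M j i = -1) := by
    intro h
    rcases lt_or_gt_of_ne hij with h1 | h1
    · left; simp [cartan, ← hs, h, h1, h1.not_gt]
    · right; simp [cartan, ← hs, h, h1, h1.not_gt]
  conv_lhs => rw [hx]
  conv_rhs => rw [hx]
  rcases H i j hij with h | h | h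
  · have c1 : cartan M i j = 0 := by simp [cartan, h]
    have c2 : cartan M j i = 0 := by simp [cartan, ← hs, h]
    rw [h]
    simp only [pow_succ, pow_zero, one_mul, end_mul_apply, end_one_apply,
      refl_apply, refl_apply', c1, c2]
    congr 3 <;> ring
  · have c1 : cartan M i j = -1 := by simp [cartan, h]
    have c2 : cartan M j i = -1 := by simp [cartan, ← hs, h]
    rw [h]
    simp only [pow_succ, pow_zero, one_mul, end_mul_apply, end_one_apply,
      refl_apply, refl_apply', c1, c2]
    congr 3 <;> ring
  · rw [h]
    rcases h4 h with ⟨c1, c2⟩ | ⟨c1, c2⟩ <;>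
    · simp only [pow_succ, pow_zero, one_mul, end_mul_apply, end_one_apply,
        refl_apply, refl_apply', c1, c2]
      congr 3 <;> ring

lemma simple_ne (H : ∀ i j, i ≠ j → M i j = 2 ∨ M i j = 3 ∨ M i j = 4) {i j : Fin n}
    (hij : i ≠ j) : cs.simple i ≠ cs.simple j := by
  intro h
  have h1 := congrArg (cs.lift ⟨refl M, refl_liftable H⟩) h
  rw [cs.lift_apply_simple, cs.lift_apply_simple] at h1
  have h2 := congrFun (congrFun h1 (Pi.single i 1)) i
  simp [refl, lform_single, cartan_self, hij] at h2

lemma simple_not_comm (H : ∀ i j, i ≠ j → M i j = 2 ∨ M i j = 3 ∨ M i j = 4) {i j : Fin n}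
    (hij : 3 ≤ M i j) : cs.simple i * cs.simple j ≠ cs.simple j * cs.simple i := by
  intro h
  have hne : i ≠ j := by
    rintro rfl
    rw [M.diagonal] at hij
    omega
  have h1 := congrArg (cs.lift ⟨refl M, refl_liftable H⟩) h
  rw [map_mul, map_mul, cs.lift_apply_simple, cs.lift_apply_simple] at h1
  have h2 := congrFun (congrFun h1 (Pi.single i 1)) j
  have hc : cartan M j i ≠ 0 := by
    unfold cartan
    rw [M.symmetric j i]
    split_ifs <;> omega
  have hx : (Pi.single i 1 : Fin n → ℤ) = 0 + Pi.single i 1 + Pi.single j 0 := by simp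
  rw [hx] at h2
  simp only [end_mul_apply, refl_apply, refl_apply', map_zero] at h2
  simp [hne] at h2
  omega

lemma matrix_cases (hM : M = CoxeterMatrix.A n ∨ M = CoxeterMatrix.B n) (i j : Fin n)
    (hij : i ≠ j) : M i j = 2 ∨ M i j = 3 ∨ M i j = 4 := by
  rcases hM with rfl | rfl
  · simp only [CoxeterMatrix.A, Matrix.of_apply, hij, if_false]
    split_ifs <;> simp
  · simp only [CoxeterMatrix.B, Matrix.of_apply, hij, if_false]
    split_ifs <;> simp

end BS

namespace BS
variable {M : CoxeterMatrix B} (cs : CoxeterSystem M W)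

lemma wp2 (i j : B) (v : List B) :
    cs.wordProd (i :: j :: v) = cs.simple i * cs.simple j * cs.wordProd v := by
  simp [cs.wordProd_cons, mul_assoc]

lemma braid_two {i j : B} (h : M i j = 2) :
    cs.simple i * cs.simple j = cs.simple j * cs.simple i := by
  have h1 := cs.simple_mul_simple_pow i j
  rw [h, pow_two] at h1
  simpa using eq_inv_of_mul_eq_one_left h1

lemma braid_three {i j : B} (h : M i j = 3) :
    cs.simple i * cs.simple j * cs.simple i = cs.simple j * cs.simple i * cs.simple j := by
  have h1 := cs.simple_mul_simple_pow i j
  rw [h] at h1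
  have h2 : (cs.simple i * cs.simple j * cs.simple i) * (cs.simple j * cs.simple i * cs.simple j) = 1 := by
    rw [← h1]; simp only [pow_succ, pow_zero, one_mul, mul_assoc]
  simpa [mul_assoc] using eq_inv_of_mul_eq_one_left h2

lemma braid_four {i j : B} (h : M i j = 4) :
    cs.simple i * cs.simple j * cs.simple i * cs.simple j =
      cs.simple j * cs.simple i * cs.simple j * cs.simple i := by
  have h1 := cs.simple_mul_simple_pow i j
  rw [h] at h1
  have h2 : (cs.simple i * cs.simple j * cs.simple i * cs.simple j) *
      (cs.simple i * cs.simple j * cs.simple i * cs.simple j) = 1 := by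
    rw [← h1]; simp only [pow_succ, pow_zero, one_mul, mul_assoc]
  simpa [mul_assoc] using eq_inv_of_mul_eq_one_left h2

lemma BStep.wordProd_eq {a b : List B} (h : BStep M a b) : cs.wordProd a = cs.wordProd b := by
  cases h with
  | m2 u v i j h =>
    rw [cs.wordProd_append, cs.wordProd_append]
    have := congrArg (· * cs.wordProd v) (braid_two cs h)
    simp only [mul_assoc] at this
    simp only [cs.wordProd_cons, this]
  | m3 u v i j h =>
    rw [cs.wordProd_append, cs.wordProd_append]
    have := congrArg (· * cs.wordProd v) (braid_three cs h)
    simp only [mul_assoc] at this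
    simp only [cs.wordProd_cons, this]
  | m4 u v i j h =>
    rw [cs.wordProd_append, cs.wordProd_append]
    have := congrArg (· * cs.wordProd v) (braid_four cs h)
    simp only [mul_assoc] at this
    simp only [cs.wordProd_cons, this]

lemma BStep.length_eq {a b : List B} (h : BStep M a b) : a.length = b.length := by
  cases h <;> simp

lemma BEq.wordProd_eq {a b : List B} (h : BEq M a b) : cs.wordProd a = cs.wordProd b := by
  induction h with
  | refl => rfl
  | tail _ hs ih => rw [ih, hs.wordProd_eq cs]

lemma BEq.length_eq {a b : List B} (h : BEq M a b) : a.length = b.length := by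
  induction h with
  | refl => rfl
  | tail _ hs ih => rw [ih, hs.length_eq]

lemma reduced_of_eq {a b : List B} (ha : cs.IsReduced a) (hp : cs.wordProd a = cs.wordProd b)
    (hl : a.length = b.length) : cs.IsReduced b := by
  unfold CoxeterSystem.IsReduced at *
  rw [← hp, ha, hl]

/-- Hypotheses on the Coxeter system which hold in types A and B. -/
structure Nice (cs : CoxeterSystem M W) : Prop where
  small : ∀ i j, i ≠ j → M i j = 2 ∨ M i j = 3 ∨ M i j = 4
  ne : ∀ i j, i ≠ j → cs.simple i ≠ cs.simple j
  nc : ∀ i j, 3 ≤ M i j → cs.simple i * cs.simple j ≠ cs.simple j * cs.simple i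

lemma dihedral_two (H : Nice cs) {x : W} {i j : B} (hij : i ≠ j) (hi : cs.IsLeftDescent x i)
    (hj : cs.IsLeftDescent x j) :
    ∃ v, cs.wordProd (i :: j :: v) = x ∧ (i :: j :: v).length = cs.length x := by
  obtain ⟨v, hv, he⟩ := cs.exists_isReduced (cs.simple j * x)
  have hp : cs.wordProd (j :: v) = x := by rw [cs.wordProd_cons, ← he]; simp
  have hl : (j :: v).length = cs.length x := by
    rw [List.length_cons, ← hv.eq, ← he]; exact cs.isLeftDescent_iff.1 hj
  obtain ⟨k, hk, hx⟩ := left_exchange cs (ω := j :: v) (i := i) (by rw [hp]; exact hi)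
  rw [hp] at hx
  cases k with
  | zero =>
    exfalso
    rw [← hp, List.eraseIdx_cons_zero, cs.wordProd_cons, cs.wordProd_cons] at hx
    exact H.ne i j hij (mul_right_cancel hx)
  | succ k =>
    rw [List.eraseIdx_cons_succ] at hx
    refine ⟨_, hx, ?_⟩
    rw [← hl]
    simp only [List.length_cons] at hk ⊢
    rw [List.length_eraseIdx_of_lt (by omega)]
    omega

lemma dihedral_three (H : Nice cs) {x : W} {i j : B} (hij : i ≠ j) (hM : 3 ≤ M i j)
    (hi : cs.IsLeftDescent x i) (hj : cs.IsLeftDescent x j) :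
    ∃ v, cs.wordProd (i :: j :: i :: v) = x ∧ (i :: j :: i :: v).length = cs.length x := by
  obtain ⟨v, hp, hl⟩ := dihedral_two cs H hij.symm hj hi
  obtain ⟨k, hk, hx⟩ := left_exchange cs (ω := j :: i :: v) (i := i) (by rw [hp]; exact hi)
  rw [hp] at hx
  match k with
  | 0 =>
    exfalso
    rw [← hp, List.eraseIdx_cons_zero, cs.wordProd_cons, cs.wordProd_cons j] at hx
    exact H.ne i j hij (mul_right_cancel hx)
  | 1 =>
    exfalso
    rw [← hp, List.eraseIdx_cons_succ, List.eraseIdx_cons_zero, wp2, wp2] at hx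
    exact H.nc i j hM (mul_right_cancel hx)
  | k + 2 =>
    rw [List.eraseIdx_cons_succ, List.eraseIdx_cons_succ] at hx
    refine ⟨_, hx, ?_⟩
    rw [← hl]
    simp only [List.length_cons] at hk ⊢
    rw [List.length_eraseIdx_of_lt (by omega)]
    omega

lemma dihedral_four (H : Nice cs) {x : W} {i j : B} (hij : i ≠ j) (hM : M i j = 4)
    (hi : cs.IsLeftDescent x i) (hj : cs.IsLeftDescent x j) :
    ∃ v, cs.wordProd (i :: j :: i :: j :: v) = x ∧
      (i :: j :: i :: j :: v).length = cs.length x := by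
  obtain ⟨v, hp, hl⟩ := dihedral_three cs H hij.symm (by rw [M.symmetric]; omega) hj hi
  obtain ⟨k, hk, hx⟩ := left_exchange cs (ω := j :: i :: j :: v) (i := i) (by rw [hp]; exact hi)
  rw [hp] at hx
  match k with
  | 0 =>
    exfalso
    rw [← hp, List.eraseIdx_cons_zero, cs.wordProd_cons, cs.wordProd_cons j] at hx
    exact H.ne i j hij (mul_right_cancel hx)
  | 1 =>
    exfalso
    rw [← hp, List.eraseIdx_cons_succ, List.eraseIdx_cons_zero, wp2, wp2] at hx
    exact H.nc i j (by omega) (mul_right_cancel hx)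
  | 2 =>
    exfalso
    rw [← hp, List.eraseIdx_cons_succ, List.eraseIdx_cons_succ, List.eraseIdx_cons_zero,
      cs.wordProd_cons, wp2, wp2, cs.wordProd_cons, ← mul_assoc, ← mul_assoc, ← mul_assoc] at hx
    have h3 := mul_right_cancel hx
    have h4 := braid_four cs hM
    rw [h3] at h4
    exact H.ne i j hij (mul_left_cancel h4).symm
  | k + 3 =>
    rw [List.eraseIdx_cons_succ, List.eraseIdx_cons_succ, List.eraseIdx_cons_succ] at hx
    refine ⟨_, hx, ?_⟩
    rw [← hl]
    simp only [List.length_cons] at hk ⊢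
    rw [List.length_eraseIdx_of_lt (by omega)]
    omega

lemma dihedral (H : Nice cs) {x : W} {i j : B} (hij : i ≠ j)
    (hi : cs.IsLeftDescent x i) (hj : cs.IsLeftDescent x j) :
    ∃ a b, BStep M (i :: a) (j :: b) ∧ cs.wordProd (i :: a) = x ∧
      (i :: a).length = cs.length x := by
  rcases H.small i j hij with h | h | h
  · obtain ⟨v, h1, h2⟩ := dihedral_two cs H hij hi hj
    exact ⟨_, _, .m2 [] v i j h, h1, h2⟩
  · obtain ⟨v, h1, h2⟩ := dihedral_three cs H hij (by omega) hi hj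
    exact ⟨_, _, .m3 [] v i j h, h1, h2⟩
  · obtain ⟨v, h1, h2⟩ := dihedral_four cs H hij h hi hj
    exact ⟨_, _, .m4 [] v i j h, h1, h2⟩

lemma reduced_cons {i : B} {a : List B} (h : cs.IsReduced (i :: a)) :
    cs.IsReduced a ∧ cs.IsLeftDescent (cs.wordProd (i :: a)) i := by
  have h1 : cs.IsReduced a := by simpa using h.drop 1
  refine ⟨h1, ?_⟩
  unfold CoxeterSystem.IsLeftDescent
  rw [h.eq, cs.wordProd_cons, cs.simple_mul_simple_cancel_left, h1.eq]
  simp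

/-- The theorem of Matsumoto. -/
theorem matsumoto (H : Nice cs) (a b : List B) (ha : cs.IsReduced a) (hb : cs.IsReduced b)
    (hab : cs.wordProd a = cs.wordProd b) : BEq M a b := by
  induction hn : a.length using Nat.strong_induction_on generalizing a b with
  | _ n ih =>
    have hl : a.length = b.length := by rw [← ha.eq, ← hb.eq, hab]
    match a, b with
    | [], [] => exact .refl
    | i :: a, j :: b =>
      simp only [List.length_cons] at hn hl
      have same : ∀ (k : B) (c d : List B), c.length < n → cs.IsReduced (k :: c) →
          cs.IsReduced (k :: d) → cs.wordProd (k :: c) = cs.wordProd (k :: d) →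
          BEq M (k :: c) (k :: d) := by
        intro k c d hc h1 h2 h3
        apply BEq.cons
        rw [cs.wordProd_cons, cs.wordProd_cons] at h3
        exact ih _ hc c d (reduced_cons cs h1).1 (reduced_cons cs h2).1 (mul_left_cancel h3) rfl
      by_cases hij : i = j
      · subst hij
        exact same i a b (by omega) ha hb hab
      · obtain ⟨c, d, hs, hp, hcl⟩ := dihedral cs H hij (reduced_cons cs ha).2
          (by rw [hab]; exact (reduced_cons cs hb).2)
        rw [ha.eq] at hcl
        have hc : cs.IsReduced (i :: c) := reduced_of_eq cs ha hp.symm hcl.symm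
        have hd : cs.IsReduced (j :: d) := reduced_of_eq cs hc (hs.wordProd_eq cs) hs.length_eq
        have hdl := hs.length_eq
        simp only [List.length_cons] at hcl hdl
        refine (same i a c (by omega) ha hc hp.symm).trans
          ((Relation.ReflTransGen.single hs).trans ?_)
        exact same j d b (by omega) hd hb (by rw [← hs.wordProd_eq cs, hp, hab])
    | [], _ :: _ => simp at hl
    | _ :: _, [] => simp at hl

lemma Good.ceq_of_beq {a b : List B} (hg : Good M a) (h : BEq M a b) : CEq M a b := by
  induction h with
  | refl => exact .refl
  | tail _ hs ih =>
    cases hs with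
    | m2 u v i j h => exact ih.tail (.mk u v i j h)
    | m3 u v i j h => exact absurd (.m3 u v i j h) (hg _ ih)
    | m4 u v i j h => exact absurd (.m4 u v i j h) (hg _ ih)

lemma Good.tail {i : B} {a : List B} (hg : Good M (i :: a)) : Good M a := by
  intro b hb hbad
  apply hg _ (hb.cons i)
  cases hbad with
  | sq u v k => exact .sq (i :: u) v k
  | m3 u v k j h => exact .m3 (i :: u) v k j h
  | m4 u v k j h => exact .m4 (i :: u) v k j h

lemma Good.reduced (H : Nice cs) {a : List B} (hg : Good M a) : cs.IsReduced a := by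
  induction a with
  | nil => simp [CoxeterSystem.IsReduced]
  | cons i a ih =>
    have ha := ih hg.tail
    by_contra hn
    have hd : cs.IsLeftDescent (cs.wordProd a) i := by
      by_contra hnd
      apply hn
      unfold CoxeterSystem.IsReduced
      rw [cs.wordProd_cons, cs.not_isLeftDescent_iff.1 hnd, ha.eq, List.length_cons]
    obtain ⟨v, hv, he⟩ := cs.exists_isReduced (cs.simple i * cs.wordProd a)
    have hp : cs.wordProd (i :: v) = cs.wordProd a := by rw [cs.wordProd_cons, ← he]; simp
    have hl : (i :: v).length = a.length := by
      rw [List.length_cons, ← hv.eq, ← he, ← ha.eq]; exact cs.isLeftDescent_iff.1 hd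
    have hb := matsumoto cs H a (i :: v) ha (reduced_of_eq cs ha hp.symm hl.symm) hp.symm
    exact hg _ ((hg.tail.ceq_of_beq hb).cons i) (.sq [] v i)

lemma Good.fc (H : Nice cs) {a : List B} (hg : Good M a) : cs.FC (cs.wordProd a) := by
  rintro ⟨x₁, x₂, i, j, h3, he, hl⟩
  have ha := hg.reduced cs H
  obtain ⟨u, hu, rfl⟩ := cs.exists_isReduced x₁
  obtain ⟨v, hv, rfl⟩ := cs.exists_isReduced x₂
  rw [← cs.wordProd_append, ← cs.wordProd_append] at he
  rw [ha.eq, hu.eq, hv.eq] at hl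
  have hr : cs.IsReduced (u ++ braidWord M i j ++ v) :=
    reduced_of_eq cs ha he (by simp [hl, add_assoc])
  have hc := hg.ceq_of_beq (matsumoto cs H _ _ ha hr he)
  have hij : i ≠ j := by
    rintro rfl
    rw [M.diagonal] at h3
    omega
  apply hg _ hc
  rcases H.small i j hij with h | h | h
  · omega
  · have := Bad.m3 (M := M) u v j i (by rw [M.symmetric]; exact h)
    simpa [braidWord, h, alternatingWord] using this
  · have := Bad.m4 (M := M) u v i j h
    simpa [braidWord, h, alternatingWord] using this

lemma ceq_of_fc (H : Nice cs) {a b : List B} (ha : cs.IsReduced a) (hb : cs.IsReduced b)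
    (hab : cs.wordProd a = cs.wordProd b) (hfc : cs.FC (cs.wordProd a)) : CEq M a b := by
  have cplx : ∀ (u v : List B) (i j : B), 3 ≤ M i j →
      cs.IsReduced (u ++ braidWord M i j ++ v) →
      cs.IsComplexElt (cs.wordProd (u ++ braidWord M i j ++ v)) := by
    intro u v i j h hr
    refine ⟨cs.wordProd u, cs.wordProd v, i, j, h, by simp [cs.wordProd_append, mul_assoc], ?_⟩
    have h1 : cs.IsReduced v := by
      simpa using hr.drop (u ++ braidWord M i j).length
    have h2 : cs.IsReduced u := by
      simpa using hr.take u.length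
    rw [hr.eq, h1.eq, h2.eq]
    simp [add_assoc]
  have key := matsumoto cs H a b ha hb hab
  clear hb hab
  induction key with
  | refl => exact .refl
  | @tail c d hac hs ih =>
    have hc : cs.IsReduced c := reduced_of_eq cs ha (BEq.wordProd_eq cs hac) (BEq.length_eq hac)
    rw [BEq.wordProd_eq cs hac] at hfc
    cases hs with
    | m2 u v i j h => exact ih.tail (.mk u v i j h)
    | m3 u v i j h =>
      exfalso
      have h' : M j i = 3 := by rw [M.symmetric]; exact h
      have := cplx u v j i (by omega)
      simp only [braidWord, h', alternatingWord] at this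
      simp at this
      exact hfc (this hc)
    | m4 u v i j h =>
      exfalso
      have := cplx u v i j (by omega)
      simp only [braidWord, h, alternatingWord] at this
      simp at this
      exact hfc (this hc)

end BS

/-- If `s_1 ⋯ s_n` is a reduced expression in a Coxeter group of type `A` or `B` and
`κ = s_{i_1} ⋯ s_{i_k}` is a subword, then in `TL(X)` the product
`b_{s_{i_1}} ⋯ b_{s_{i_k}}` equals `a q_c^m b_x`, where `a`, `m` are nonnegative integers and
`x` is fully commutative with `ℓ(x) ≤ k` and `x ≤ w` in Bruhat--Chevalley order. -/
theorem bprod_sublist_eq {n : ℕ} {M : CoxeterMatrix (Fin n)}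
    (hM : M = CoxeterMatrix.Aₙ n ∨ M = CoxeterMatrix.Bₙ n)
    (cs : CoxeterSystem M W) (ω : List (Fin n)) (hred : cs.IsReduced ω)
    (κ : List (Fin n)) (hκ : κ.Sublist ω) :
    ∃ (x : W) (a m : ℕ), cs.FC x ∧ cs.length x ≤ κ.length ∧
      cs.BruhatLE x (cs.wordProd ω) ∧
      ∀ ωx : List (Fin n), cs.IsReduced ωx → cs.wordProd ωx = x →
        bprod M κ = a • (qc ^ m • bprod M ωx) := by

  have H := BS.matrix_cases hM
  have hN : BS.Nice cs :=
    ⟨H, fun i j h => BS.simple_ne cs H h, fun i j h => BS.simple_not_comm cs H h⟩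
  obtain ⟨b, a, m, hb, hg, he⟩ := BS.exists_good (M := M) κ
  have hr := hg.reduced cs hN
  refine ⟨cs.wordProd b, a, m, hg.fc cs hN, ?_, ⟨ω, hred, rfl, b, hb.trans hκ, rfl⟩, ?_⟩
  · rw [hr.eq]; exact hb.length_le
  · intro ωx hx hp
    rw [he, (BS.ceq_of_fc cs hN hr hx hp.symm (hg.fc cs hN)).bprod_eq]
end
end
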